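/- arXiv:1003.5639 — 2 statements merged into one kernel-verified Lean document; each statement's English description precedes it below -/
import Mathlib

section
/- Let (M,u) be a valued field, K a subfield with v = u restricted to K, and let F and L be intermediate fields of M|K such that (F|K,v) is an immediate extension and (L|K,v) is a finite defectless extension admitting a unique extension of the valuation from K to L. Then the compositum F.L satisfies: (F.L|F,u) is a finite defectless extension admitting a unique extension of the valuation from F to F.L, (F.L|L,u) is immediate, and [F.L:F] = [L:K], i.e., F is linearly disjoint from L over K. -/
open scoped Classical

noncomputable section

namespace ValuedDefect

universe u v

variable {K : Type u} {L : Type v} [Field K] [Field L]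

/-- The ramification index `(vL : vK)`: the index of the image of `Kˣ` in the
value group `Lˣ / Bˣ` of the valuation subring `B` of `L`. -/
def ramIndex (K : Type u) {L : Type v} [Field K] [Field L] [Algebra K L]
    (B : ValuationSubring L) : ℕ :=
  (Subgroup.map (QuotientGroup.mk' B.unitGroup)
    (MonoidHom.range (Units.map (algebraMap K L).toMonoidHom))).index

/-- The ring homomorphism `A →+* B` induced by `algebraMap K L` when `B` lies above `A`. -/
def valHom [Algebra K L] (A : ValuationSubring K) (B : ValuationSubring L)
    (h : B.comap (algebraMap K L) = A) : A →+* B where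
  toFun x := ⟨algebraMap K L x, by
    have hx : (x : K) ∈ B.comap (algebraMap K L) := by rw [h]; exact x.2
    exact ValuationSubring.mem_comap.mp hx⟩
  map_one' := Subtype.ext (by simp)
  map_mul' x y := Subtype.ext (by simp)
  map_zero' := Subtype.ext (by simp)
  map_add' x y := Subtype.ext (by simp)

theorem valHom_isLocalHom [Algebra K L] (A : ValuationSubring K) (B : ValuationSubring L)
    (h : B.comap (algebraMap K L) = A) : IsLocalHom (valHom A B h) := by
  constructor
  intro x hx
  rcases isUnit_iff_exists_inv.mp hx with ⟨y, hy⟩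
  have hy' : algebraMap K L (x : K) * (y : L) = 1 := congrArg Subtype.val hy
  have hx0 : (x : K) ≠ 0 := by
    rintro h0
    rw [h0, map_zero, zero_mul] at hy'
    exact zero_ne_one hy'
  have hyx : (y : L) = algebraMap K L ((x : K)⁻¹) := by
    rw [map_inv₀]
    exact eq_inv_of_mul_eq_one_right hy'
  have hmem : ((x : K)⁻¹ : K) ∈ A := by
    have hB : algebraMap K L ((x : K)⁻¹) ∈ B := hyx ▸ y.2
    have := ValuationSubring.mem_comap.mpr hB
    rwa [h] at this
  refine isUnit_iff_exists_inv.mpr ⟨⟨(x : K)⁻¹, hmem⟩, Subtype.ext ?_⟩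
  exact mul_inv_cancel₀ hx0

/-- The residue degree `[Lv : Kv]` of an extension of valuation subrings. -/
def residueDegree [Algebra K L] (A : ValuationSubring K) (B : ValuationSubring L) : ℕ :=
  if h : B.comap (algebraMap K L) = A then
    letI := valHom_isLocalHom A B h
    letI := (IsLocalRing.ResidueField.map (valHom A B h)).toAlgebra
    Module.finrank (IsLocalRing.ResidueField A) (IsLocalRing.ResidueField B)
  else 0

/-- A finite extension of valued fields (with unique extension of the valuation) is
defectless if `[L : K] = (vL : vK) · [Lv : Kv]`. -/
def IsDefectless [Algebra K L] (A : ValuationSubring K) (B : ValuationSubring L) : Prop :=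
  Module.finrank K L = ramIndex K B * residueDegree A B

/-- An extension of valued fields is immediate if `vL = vK` and `Lv = Kv`. -/
def IsImmediate (K : Type u) {L : Type v} [Field K] [Field L] [Algebra K L]
    (B : ValuationSubring L) : Prop :=
  (∀ x : L, x ≠ 0 → ∃ c : K, B.valuation x = B.valuation (algebraMap K L c)) ∧
  ∀ x : L, B.valuation x ≤ 1 → ∃ c : K, B.valuation (x - algebraMap K L c) < 1

/-- A valued field is a defectless field if every finite extension is defectless. -/
def IsDefectlessField {K : Type u} [Field K] (A : ValuationSubring K) : Prop :=
  ∀ (L : Type u) [Field L] [Algebra K L], FiniteDimensional K L →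
    ∀ B : ValuationSubring L, B.comap (algebraMap K L) = A → IsDefectless A B

/-- A valued field is a separably defectless field if every finite separable extension is
defectless. -/
def IsSepDefectlessField {K : Type u} [Field K] (A : ValuationSubring K) : Prop :=
  ∀ (L : Type u) [Field L] [Algebra K L], FiniteDimensional K L → Algebra.IsSeparable K L →
    ∀ B : ValuationSubring L, B.comap (algebraMap K L) = A → IsDefectless A B

/-- A valued field is inseparably defectless if every finite purely inseparable extension is
defectless. -/
def IsInsepDefectless {K : Type u} [Field K] (A : ValuationSubring K) : Prop :=
  ∀ (L : Type u) [Field L] [Algebra K L], FiniteDimensional K L → IsPurelyInseparable K L →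
    ∀ B : ValuationSubring L, B.comap (algebraMap K L) = A → IsDefectless A B

/-- A valued field is algebraically maximal if it admits no proper immediate algebraic
extension. -/
def IsAlgMaximal {K : Type u} [Field K] (A : ValuationSubring K) : Prop :=
  ∀ (L : Type u) [Field L] [Algebra K L], Algebra.IsAlgebraic K L →
    ∀ B : ValuationSubring L, B.comap (algebraMap K L) = A → IsImmediate K B →
      Function.Surjective (algebraMap K L)

/-- A valued field is separable-algebraically maximal if it admits no proper immediate
separable-algebraic extension. -/
def IsSepAlgMaximal {K : Type u} [Field K] (A : ValuationSubring K) : Prop :=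
  ∀ (L : Type u) [Field L] [Algebra K L], Algebra.IsAlgebraic K L → Algebra.IsSeparable K L →
    ∀ B : ValuationSubring L, B.comap (algebraMap K L) = A → IsImmediate K B →
      Function.Surjective (algebraMap K L)

/-- `(K,v)` is `K`-extremal with respect to `f` if the set `{v f(a) : a ∈ K}` has a maximum
(in the multiplicative convention: a minimum). -/
def KExtremal (A : ValuationSubring K) (f : Polynomial K) : Prop :=
  ∃ a : K, ∀ b : K, A.valuation (f.eval a) ≤ A.valuation (f.eval b)

/-- `(K,v)` is `O`-extremal with respect to `f` if the set `{v f(a) : a ∈ O}` has a maximum. -/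
def OExtremal (A : ValuationSubring K) (f : Polynomial K) : Prop :=
  ∃ a : A, ∀ b : A, A.valuation (f.eval (a : K)) ≤ A.valuation (f.eval (b : K))

/-- `K`-extremality for multivariable polynomials. -/
def KExtremalMv (A : ValuationSubring K) {n : ℕ} (f : MvPolynomial (Fin n) K) : Prop :=
  ∃ a : Fin n → K, ∀ b : Fin n → K,
    A.valuation (MvPolynomial.eval a f) ≤ A.valuation (MvPolynomial.eval b f)

/-- A `p`-polynomial: an additive polynomial plus a constant. -/
def IsPPolynomial (p : ℕ) (f : Polynomial K) : Prop :=
  ∃ (c : K) (m : ℕ) (co : ℕ → K),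
    f = Polynomial.C c + ∑ i ∈ Finset.range (m + 1), Polynomial.C (co i) * Polynomial.X ^ p ^ i

/-- A field of characteristic `p > 0` is Artin-Schreier closed if every polynomial
`X^p - X - a` has a root. -/
def ASClosed (K : Type*) [Field K] (p : ℕ) : Prop :=
  ∀ a : K, ∃ x : K, x ^ p - x = a

/-- The subfield `K^p` of `p`-th powers of a field of characteristic `p`. -/
def pPowerSubfield (K : Type*) [Field K] (p : ℕ) (hp : p.Prime) [CharP K p] : Subfield K :=
  haveI : Fact p.Prime := ⟨hp⟩
  (frobenius K p).fieldRange

/-- The field `K^{1/p}` of `p`-th roots of `K` inside a purely inseparable extension `P`. -/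
def pthRootField (K : Type u) (P : Type v) [Field K] [Field P] [Algebra K P]
    (p : ℕ) (hp : p.Prime) [CharP K p] : IntermediateField K P :=
  haveI : Fact p.Prime := ⟨hp⟩
  haveI : CharP P p := charP_of_injective_algebraMap (algebraMap K P).injective p
  { carrier := {x : P | x ^ p ∈ (algebraMap K P).range}
    mul_mem' := fun {a b} ha hb => by
      rcases ha with ⟨c, hc⟩
      rcases hb with ⟨d, hd⟩
      exact ⟨c * d, by rw [map_mul, hc, hd, mul_pow]⟩
    one_mem' := ⟨1, by rw [map_one, one_pow]⟩
    add_mem' := fun {a b} ha hb => by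
      rcases ha with ⟨c, hc⟩
      rcases hb with ⟨d, hd⟩
      exact ⟨c + d, by rw [map_add, hc, hd, add_pow_char]⟩
    zero_mem' := ⟨0, by rw [map_zero, zero_pow hp.ne_zero]⟩
    algebraMap_mem' := fun r => ⟨r ^ p, by rw [map_pow]⟩
    inv_mem' := fun x hx => by
      rcases hx with ⟨c, hc⟩
      exact ⟨c⁻¹, by rw [map_inv₀, hc, inv_pow]⟩ }

/-- A (possibly infinite) algebraic extension of valued fields is defectless if every finite
subextension is defectless. -/
def IsDefectlessAlgExt {K : Type u} {L : Type v} [Field K] [Field L] [Algebra K L]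
    (A : ValuationSubring K) (B : ValuationSubring L) : Prop :=
  ∀ E : IntermediateField K L, FiniteDimensional K E →
    IsDefectless A (B.comap (algebraMap E L))


section ValuationBasis

variable {Γ : Type*} [LinearOrderedCommGroupWithZero Γ]

/-- The members of the family `x` have values in distinct cosets of the value group of `K`. -/
structure IsValueIndep (K : Type*) {L ι : Type*} [Field K] [Field L] [Algebra K L]
    (w : Valuation L Γ) (x : ι → L) : Prop where
  ne_zero : ∀ i, x i ≠ 0
  eq_of_value_eq : ∀ (i j : ι) (c : K), w (x i) = w (algebraMap K L c * x j) → i = j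

/-- The family `x` represents the cosets of the value group of `K` in the value group of `L`. -/
structure IsValueReps (K : Type*) {L ι : Type*} [Field K] [Field L] [Algebra K L]
    (w : Valuation L Γ) (x : ι → L) : Prop extends IsValueIndep K w x where
  exists_value_eq : ∀ z : L, z ≠ 0 → ∃ (i : ι) (c : K), w z = w (algebraMap K L c * x i)

/-- The family `y` is integral and its residues are linearly independent over the residue field
of `K`. -/
structure IsResidueIndep (K : Type*) {L κ : Type*} [Field K] [Field L] [Algebra K L] [Fintype κ]
    (w : Valuation L Γ) (y : κ → L) : Prop where
  le_one : ∀ j, w (y j) ≤ 1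
  coeff_lt_one : ∀ c : κ → K, (∀ j, w (algebraMap K L (c j)) ≤ 1) →
    w (∑ j, algebraMap K L (c j) * y j) < 1 → ∀ j, w (algebraMap K L (c j)) < 1

/-- The family `y` reduces to a basis of the residue field of `L` over that of `K`. -/
structure IsResidueBasis (K : Type*) {L κ : Type*} [Field K] [Field L] [Algebra K L] [Fintype κ]
    (w : Valuation L Γ) (y : κ → L) : Prop extends IsResidueIndep K w y where
  exists_approx : ∀ z : L, w z ≤ 1 → ∃ c : κ → K, (∀ j, w (algebraMap K L (c j)) ≤ 1) ∧
    w (z - ∑ j, algebraMap K L (c j) * y j) < 1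

/-- The value of a `K`-linear combination of the nonzero family `b` is the maximum of the values
of its terms. -/
structure IsValueOrthogonal (K : Type*) {L ι : Type*} [Field K] [Field L] [Algebra K L]
    [Fintype ι] (w : Valuation L Γ) (b : ι → L) : Prop where
  ne_zero : ∀ k, b k ≠ 0
  value_le_value_sum : ∀ (c : ι → K) (k : ι),
    w (algebraMap K L (c k) * b k) ≤ w (∑ k, algebraMap K L (c k) * b k)

/-- Every nonzero element of `L` has the same leading term as some element of `K`. -/
def HasLeadingTerms (K : Type*) {L : Type*} [Field K] [Field L] [Algebra K L]
    (w : Valuation L Γ) : Prop :=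
  ∀ z : L, z ≠ 0 → ∃ c : K, w (z - algebraMap K L c) < w z

theorem value_eq_of_sub_lt {L : Type*} [Field L] (w : Valuation L Γ) {z t : L}
    (h : w (z - t) < w z) : w t = w z := by
  have := Valuation.map_sub_eq_of_lt_left w h
  rwa [sub_sub_cancel] at this

theorem isImmediate_iff_hasLeadingTerms [Algebra K L] (w : Valuation L Γ) :
    IsImmediate K w.valuationSubring ↔ HasLeadingTerms K w := by
  have hE := w.isEquiv_valuation_valuationSubring
  have hlt : ∀ z, w.valuationSubring.valuation z < 1 ↔ w z < 1 := fun z =>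
    (Valuation.isEquiv_iff_val_lt_one.mp hE).symm
  have hle : ∀ z, w.valuationSubring.valuation z ≤ 1 ↔ w z ≤ 1 := fun z =>
    (Valuation.isEquiv_iff_val_le_one.mp hE).symm
  have heq : ∀ z t, w.valuationSubring.valuation z = w.valuationSubring.valuation t ↔
      w z = w t := fun z t => by
    rw [le_antisymm_iff, le_antisymm_iff, hE z t, hE t z]
  simp only [IsImmediate, HasLeadingTerms, hlt, hle, heq]
  constructor
  · rintro ⟨h1, h2⟩ z hz
    obtain ⟨c, hc⟩ := h1 z hz
    have hwz : w z ≠ 0 := (w.ne_zero_iff).mpr hz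
    have hc0 : algebraMap K L c ≠ 0 := by
      intro h0
      rw [h0, map_zero] at hc
      exact hwz hc
    have hwc : 0 < w (algebraMap K L c) := zero_lt_iff.mpr ((w.ne_zero_iff).mpr hc0)
    obtain ⟨d, hd⟩ := h2 (z / algebraMap K L c) (by
      rw [map_div₀, hc, div_self hwc.ne'])
    refine ⟨d * c, ?_⟩
    have : z - algebraMap K L (d * c) =
        (z / algebraMap K L c - algebraMap K L d) * algebraMap K L c := by
      rw [map_mul]
      field_simp
    rw [this, map_mul, hc]
    exact mul_lt_of_lt_one_left hwc hd
  · intro h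
    refine ⟨fun z hz => ?_, fun z hz => ?_⟩
    · obtain ⟨c, hc⟩ := h z hz
      exact ⟨c, (value_eq_of_sub_lt w hc).symm⟩
    · rcases eq_or_ne z 0 with rfl | h0
      · exact ⟨0, by simp⟩
      · obtain ⟨c, hc⟩ := h z h0
        exact ⟨c, hc.trans_le hz⟩

theorem IsResidueIndep.exists_value_sum_eq [Algebra K L] {κ : Type*} [Fintype κ]
    {w : Valuation L Γ} {y : κ → L} (hy : IsResidueIndep K w y) (c : κ → K) :
    ∃ a : K, w (∑ j, algebraMap K L (c j) * y j) = w (algebraMap K L a) ∧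
      ∀ j, w (algebraMap K L (c j)) ≤ w (algebraMap K L a) := by
  rcases isEmpty_or_nonempty κ with hκ | hκ
  · exact ⟨0, by simp, fun j => hκ.elim j⟩
  obtain ⟨j₀, hj₀⟩ := Finite.exists_max fun j => w (algebraMap K L (c j))
  refine ⟨c j₀, ?_, hj₀⟩
  refine le_antisymm (Valuation.map_sum_le w fun j _ => ?_) ?_
  · rw [map_mul]
    exact (mul_le_of_le_one_right' (hy.le_one j)).trans (hj₀ j)
  rcases eq_or_ne (c j₀) 0 with h0 | h0
  · simp [h0]
  have h0' : algebraMap K L (c j₀) ≠ 0 := by simpa using h0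
  have hw0 : 0 < w (algebraMap K L (c j₀)) := zero_lt_iff.mpr ((w.ne_zero_iff).mpr h0')
  have hsum : ∑ j, algebraMap K L (c j) * y j =
      algebraMap K L (c j₀) * ∑ j, algebraMap K L (c j / c j₀) * y j := by
    rw [Finset.mul_sum]
    refine Finset.sum_congr rfl fun j _ => ?_
    rw [map_div₀]
    field_simp
  have hge : 1 ≤ w (∑ j, algebraMap K L (c j / c j₀) * y j) := by
    by_contra! hlt
    have := hy.coeff_lt_one (fun j => c j / c j₀) (fun j => by
      rw [map_div₀, map_div₀]
      exact div_le_one_of_le₀ (hj₀ j) (by simp)) hlt j₀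
    simp [div_self h0] at this
  rw [hsum, map_mul]
  exact le_mul_of_one_le_right' hge

theorem IsResidueIndep.ne_zero [Algebra K L] {κ : Type*} [Fintype κ]
    {w : Valuation L Γ} {y : κ → L} (hy : IsResidueIndep K w y) (j : κ) : y j ≠ 0 := by
  intro h
  have hle : ∀ i, w (algebraMap K L ((Pi.single j 1 : κ → K) i)) ≤ 1 := fun i => by
    rcases eq_or_ne i j with rfl | hij
    · simp
    · simp [hij]
  have := hy.coeff_lt_one (Pi.single j 1) hle (by
    rw [Finset.sum_eq_single j (fun i _ hij => by simp [hij]) (by simp)]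
    simp [h]) j
  simp at this

theorem IsValueIndep.isValueOrthogonal_mul [Algebra K L] {ι κ : Type*} [Fintype ι] [Fintype κ]
    {w : Valuation L Γ} {x : ι → L} {y : κ → L} (hx : IsValueIndep K w x)
    (hy : IsResidueIndep K w y) :
    IsValueOrthogonal K w (fun k : ι × κ => x k.1 * y k.2) := by
  refine ⟨fun k => mul_ne_zero (hx.ne_zero _) (hy.ne_zero _), fun c k => ?_⟩
  have : Nonempty ι := ⟨k.1⟩
  choose a ha ha' using fun i => hy.exists_value_sum_eq fun j => c (i, j)
  set z : ι → L := fun i => ∑ j, algebraMap K L (c (i, j)) * y j with hz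
  have hsum : ∑ k, algebraMap K L (c k) * (x k.1 * y k.2) = ∑ i, x i * z i := by
    rw [Fintype.sum_prod_type]
    refine Finset.sum_congr rfl fun i _ => ?_
    rw [hz, Finset.mul_sum]
    exact Finset.sum_congr rfl fun j _ => by ring
  have hk : w (algebraMap K L (c k) * (x k.1 * y k.2)) ≤ w (x k.1 * z k.1) := by
    have h1 := hy.le_one k.2
    have h2 := ha' k.1 k.2
    rw [map_mul, map_mul, map_mul, ha, mul_left_comm]
    gcongr
    exact (mul_le_of_le_one_right' h1).trans h2
  obtain ⟨i₀, hi₀⟩ := Finite.exists_max fun i => w (x i * z i)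
  refine hk.trans ((hi₀ k.1).trans ?_)
  rcases eq_or_ne (w (x i₀ * z i₀)) 0 with h0 | h0
  · rw [h0]; simp
  rw [hsum, Valuation.map_sum_eq_of_lt w (Finset.mem_univ i₀)]
  intro i hi
  have hne : i ≠ i₀ := by simpa using hi
  refine lt_of_le_of_ne (hi₀ i) fun heq => hne ?_
  have hai : w (algebraMap K L (a i)) ≠ 0 := by
    intro h
    rw [map_mul w (x i), ha i, h, mul_zero] at heq
    exact h0 heq.symm
  refine hx.eq_of_value_eq i i₀ (a i₀ / a i) ?_
  rw [map_mul, map_mul, ha, ha] at heq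
  rw [map_mul, map_div₀, map_div₀, div_mul_eq_mul_div, eq_div_iff hai, heq, mul_comm]

theorem mk_mk_eq_mk_mk_iff [Algebra K L] (w : Valuation L Γ) (z t : Lˣ) :
    (QuotientGroup.mk (QuotientGroup.mk z : Lˣ ⧸ w.valuationSubring.unitGroup) :
      (Lˣ ⧸ w.valuationSubring.unitGroup) ⧸
        Subgroup.map (QuotientGroup.mk' w.valuationSubring.unitGroup)
          (MonoidHom.range (Units.map (algebraMap K L).toMonoidHom))) =
      QuotientGroup.mk (QuotientGroup.mk t) ↔
    ∃ c : K, w z = w (algebraMap K L c * t) := by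
  have hz : w (z : L) ≠ 0 := (w.ne_zero_iff).mpr z.ne_zero
  rw [eq_comm, QuotientGroup.eq, ← QuotientGroup.mk_inv, ← QuotientGroup.mk_mul]
  simp only [Subgroup.mem_map, MonoidHom.mem_range, QuotientGroup.mk'_apply]
  constructor
  · rintro ⟨_, ⟨c, rfl⟩, hc⟩
    rw [QuotientGroup.eq, Valuation.mem_unitGroup_iff] at hc
    refine ⟨c, ?_⟩
    have hc' : w ((algebraMap K L c)⁻¹ * ((t : L)⁻¹ * z)) = 1 := by simpa using hc
    have hwc : w (algebraMap K L c) ≠ 0 := (w.ne_zero_iff).mpr (by simp)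
    have hwt : w (t : L) ≠ 0 := (w.ne_zero_iff).mpr t.ne_zero
    simp only [map_mul, map_inv₀] at hc' ⊢
    rw [← mul_one (_ * _), ← hc']
    field_simp
  · rintro ⟨c, hc⟩
    have hc0 : c ≠ 0 := by
      rintro rfl
      simp at hc
    refine ⟨_, ⟨Units.mk0 c hc0, rfl⟩, ?_⟩
    rw [QuotientGroup.eq, Valuation.mem_unitGroup_iff]
    have hwc : w (algebraMap K L c) ≠ 0 := (w.ne_zero_iff).mpr (by simpa)
    have hwt : w (t : L) ≠ 0 := (w.ne_zero_iff).mpr t.ne_zero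
    have : w ((algebraMap K L c)⁻¹ * ((t : L)⁻¹ * z)) = 1 := by
      simp only [map_mul, map_inv₀] at hc ⊢
      rw [hc]
      field_simp
    simpa using this

theorem IsValueReps.ramIndex_eq [Algebra K L] {ι : Type*} [Fintype ι] {w : Valuation L Γ}
    {x : ι → L} (hx : IsValueReps K w x) :
    ramIndex K w.valuationSubring = Fintype.card ι := by
  rw [ramIndex, Subgroup.index, ← Nat.card_eq_fintype_card]
  refine (Nat.card_eq_of_bijective (fun i => QuotientGroup.mk
    (QuotientGroup.mk (Units.mk0 (x i) (hx.ne_zero i)))) ⟨fun i j hij => ?_, fun q => ?_⟩).symm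
  · obtain ⟨c, hc⟩ := (mk_mk_eq_mk_mk_iff w _ _).mp hij
    exact hx.eq_of_value_eq i j c hc
  · obtain ⟨q, rfl⟩ := QuotientGroup.mk_surjective q
    obtain ⟨z, rfl⟩ := QuotientGroup.mk_surjective q
    obtain ⟨i, c, h⟩ := hx.exists_value_eq z z.ne_zero
    exact ⟨i, ((mk_mk_eq_mk_mk_iff w _ _).mpr ⟨c, h⟩).symm⟩

theorem exists_isValueReps [Algebra K L] (w : Valuation L Γ)
    (h : ramIndex K w.valuationSubring ≠ 0) :
    ∃ x : Fin (ramIndex K w.valuationSubring) → L, IsValueReps K w x := by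
  have : Finite ((Lˣ ⧸ w.valuationSubring.unitGroup) ⧸
      Subgroup.map (QuotientGroup.mk' w.valuationSubring.unitGroup)
        (MonoidHom.range (Units.map (algebraMap K L).toMonoidHom))) := Nat.finite_of_card_ne_zero h
  let e := (Finite.equivFinOfCardEq (n := ramIndex K w.valuationSubring)
    (α := (Lˣ ⧸ w.valuationSubring.unitGroup) ⧸
      Subgroup.map (QuotientGroup.mk' w.valuationSubring.unitGroup)
        (MonoidHom.range (Units.map (algebraMap K L).toMonoidHom))) rfl).symm
  have hrep : ∀ i, ∃ z : Lˣ, QuotientGroup.mk (QuotientGroup.mk z) = e i := fun i => by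
    obtain ⟨q, hq⟩ := QuotientGroup.mk_surjective (e i)
    obtain ⟨z, rfl⟩ := QuotientGroup.mk_surjective q
    exact ⟨z, hq⟩
  choose x hx using hrep
  refine ⟨fun i => x i, ⟨fun i => (x i).ne_zero, fun i j c hc => ?_⟩, fun z hz => ?_⟩
  · refine e.injective ?_
    rw [← hx, ← hx]
    exact (mk_mk_eq_mk_mk_iff w _ _).mpr ⟨c, hc⟩
  · obtain ⟨i, hi⟩ := e.surjective (QuotientGroup.mk (QuotientGroup.mk (Units.mk0 z hz)))
    exact ⟨i, (mk_mk_eq_mk_mk_iff w (Units.mk0 z hz) (x i)).mp (by rw [hx, hi])⟩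

theorem residue_eq_zero_iff_value_lt_one (w : Valuation L Γ) (z : w.valuationSubring) :
    IsLocalRing.residue _ z = 0 ↔ w z < 1 := by
  rw [IsLocalRing.residue_eq_zero_iff, Valuation.mem_maximalIdeal_iff]

theorem isResidueBasis_iff [Algebra K L] {w : Valuation L Γ} {A : ValuationSubring K}
    (h : w.valuationSubring.comap (algebraMap K L) = A)
    [Algebra (IsLocalRing.ResidueField A) (IsLocalRing.ResidueField w.valuationSubring)]
    (halg : ∀ a : A, algebraMap (IsLocalRing.ResidueField A)
      (IsLocalRing.ResidueField w.valuationSubring) (IsLocalRing.residue A a) =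
        IsLocalRing.residue _ (valHom A w.valuationSubring h a))
    {κ : Type*} [Fintype κ] (y : κ → w.valuationSubring) :
    IsResidueBasis K w (fun j => (y j : L)) ↔
      LinearIndependent (IsLocalRing.ResidueField A) (fun j => IsLocalRing.residue _ (y j)) ∧
      ⊤ ≤ Submodule.span (IsLocalRing.ResidueField A)
        (Set.range fun j => IsLocalRing.residue w.valuationSubring (y j)) := by
  have hmem : ∀ c : K, w (algebraMap K L c) ≤ 1 ↔ c ∈ A := fun c => by rw [← h]; rfl
  have hsum : ∀ a : κ → A, ∑ j, IsLocalRing.residue A (a j) • IsLocalRing.residue _ (y j) =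
      IsLocalRing.residue _ (∑ j, valHom A w.valuationSubring h (a j) * y j) := fun a => by
    simp [Algebra.smul_def, halg]
  have hval : ∀ a : κ → A, ((∑ j, valHom A w.valuationSubring h (a j) * y j :
      w.valuationSubring) : L) = ∑ j, algebraMap K L (a j) * y j := fun a => by
    rw [← ValuationSubring.subtype_apply, map_sum]
    rfl
  have hzero : ∀ a : A, IsLocalRing.residue A a = 0 ↔ w (algebraMap K L a) < 1 := fun a => by
    rw [← map_eq_zero_iff _ (algebraMap (IsLocalRing.ResidueField A)
      (IsLocalRing.ResidueField w.valuationSubring)).injective, halg,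
      residue_eq_zero_iff_value_lt_one]
    rfl
  constructor
  · intro hy
    refine ⟨Fintype.linearIndependent_iff.mpr fun g hg => ?_, fun r _ => ?_⟩
    · choose a ha using fun j => IsLocalRing.residue_surjective (g j)
      obtain rfl : (fun j => IsLocalRing.residue A (a j)) = g := funext ha
      rw [hsum, residue_eq_zero_iff_value_lt_one, hval] at hg
      exact fun j => (hzero _).mpr
        (hy.coeff_lt_one (fun j => a j) (fun j => (hmem _).mpr (a j).2) hg j)
    · obtain ⟨z, rfl⟩ := IsLocalRing.residue_surjective r
      obtain ⟨c, hc, hlt⟩ := hy.exists_approx z z.2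
      refine (Submodule.mem_span_range_iff_exists_fun _).mpr
        ⟨fun j => IsLocalRing.residue A ⟨c j, (hmem _).mp (hc j)⟩, ?_⟩
      rw [hsum, eq_comm, ← sub_eq_zero, ← map_sub, residue_eq_zero_iff_value_lt_one,
        AddSubgroupClass.coe_sub, hval]
      exact hlt
  · rintro ⟨hli, hsp⟩
    refine ⟨⟨fun j => (y j).2, fun c hc hlt j => ?_⟩, fun z hz => ?_⟩
    · refine (hzero ⟨c j, (hmem _).mp (hc j)⟩).mp
        (Fintype.linearIndependent_iff.mp hli
          (fun j => IsLocalRing.residue A ⟨c j, (hmem _).mp (hc j)⟩) ?_ j)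
      rw [hsum, residue_eq_zero_iff_value_lt_one, hval]
      exact hlt
    · obtain ⟨g, hg⟩ := (Submodule.mem_span_range_iff_exists_fun _).mp
        (hsp (Submodule.mem_top (x := IsLocalRing.residue _ (⟨z, hz⟩ : w.valuationSubring))))
      choose a ha using fun j => IsLocalRing.residue_surjective (g j)
      obtain rfl : (fun j => IsLocalRing.residue A (a j)) = g := funext ha
      refine ⟨fun j => a j, fun j => (hmem _).mpr (a j).2, ?_⟩
      rw [hsum, eq_comm, ← sub_eq_zero, ← map_sub, residue_eq_zero_iff_value_lt_one,
        AddSubgroupClass.coe_sub, hval] at hg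
      exact hg

theorem IsResidueBasis.residueDegree_eq [Algebra K L] {κ : Type*} [Fintype κ]
    {w : Valuation L Γ} {y : κ → L} (hy : IsResidueBasis K w y) {A : ValuationSubring K}
    (h : w.valuationSubring.comap (algebraMap K L) = A) :
    residueDegree A w.valuationSubring = Fintype.card κ := by
  rw [residueDegree, dif_pos h]
  have := valHom_isLocalHom A w.valuationSubring h
  let := (IsLocalRing.ResidueField.map (valHom A w.valuationSubring h)).toAlgebra
  obtain ⟨hli, hsp⟩ := (isResidueBasis_iff h (fun a => rfl)
    (fun j => (⟨y j, hy.le_one j⟩ : w.valuationSubring))).mp hy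
  exact Module.finrank_eq_card_basis (Module.Basis.mk hli hsp)

theorem exists_isResidueBasis [Algebra K L] (w : Valuation L Γ) {A : ValuationSubring K}
    (h : w.valuationSubring.comap (algebraMap K L) = A)
    (hne : residueDegree A w.valuationSubring ≠ 0) :
    ∃ (n : ℕ) (y : Fin n → L), IsResidueBasis K w y := by
  rw [residueDegree, dif_pos h] at hne
  have := valHom_isLocalHom A w.valuationSubring h
  let := (IsLocalRing.ResidueField.map (valHom A w.valuationSubring h)).toAlgebra
  have : Module.Finite (IsLocalRing.ResidueField A)
      (IsLocalRing.ResidueField w.valuationSubring) :=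
    Module.finite_of_finrank_pos (Nat.pos_of_ne_zero hne)
  let b := Module.finBasis (IsLocalRing.ResidueField A)
    (IsLocalRing.ResidueField w.valuationSubring)
  choose y hy using fun j => IsLocalRing.residue_surjective (b j)
  refine ⟨_, fun j => y j, (isResidueBasis_iff h (fun a => rfl) y).mpr ?_⟩
  simp only [hy]
  exact ⟨b.linearIndependent, b.span_eq.ge⟩

theorem IsValueOrthogonal.linearIndependent [Algebra K L] {ι : Type*} [Fintype ι]
    {w : Valuation L Γ} {b : ι → L} (hb : IsValueOrthogonal K w b) : LinearIndependent K b := by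
  refine Fintype.linearIndependent_iff.mpr fun c hc k => ?_
  simp only [Algebra.smul_def] at hc
  have h := hb.value_le_value_sum c k
  rw [hc, map_zero, le_zero_iff, w.zero_iff, mul_eq_zero] at h
  simpa using h.resolve_right (hb.ne_zero k)

open Polynomial in
theorem IsValueOrthogonal.exists_monic_of_value_le_one [Algebra K L] {ι : Type*} [Fintype ι]
    {w : Valuation L Γ} (b : Module.Basis ι K L) (hb : IsValueOrthogonal K w b) {z : L}
    (hz : w z ≤ 1) :
    ∃ p : K[X], p.Monic ∧ aeval z p = 0 ∧ ∀ n, w (algebraMap K L (p.coeff n)) ≤ 1 := by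
  set N := Algebra.leftMulMatrix b z with hN
  refine ⟨N.charpoly, N.charpoly_monic, ?_, fun n => ?_⟩
  · refine Algebra.leftMulMatrix_injective b ?_
    rw [map_zero, ← Polynomial.aeval_algHom_apply]
    exact N.aeval_self_charpoly
  have hsum : ∀ j, ∑ i, algebraMap K L (N i j) * b i = z * b j := fun j => by
    simp only [hN, Algebra.leftMulMatrix_eq_repr_mul, ← Algebra.smul_def]
    exact b.sum_repr _
  have hle : ∀ i j, w (b i * algebraMap K L (N i j) * (b j)⁻¹) ≤ 1 := fun i j => by
    have hbj : 0 < w (b j) := zero_lt_iff.mpr ((w.ne_zero_iff).mpr (hb.ne_zero j))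
    have h1 := hb.value_le_value_sum (fun i => N i j) i
    rw [hsum] at h1
    rw [map_mul, map_inv₀, mul_comm (b i), ← div_eq_mul_inv, div_le_one₀ hbj]
    refine h1.trans ?_
    rw [map_mul]
    exact mul_le_of_le_one_left' hz
  let P : (Matrix ι ι L)ˣ := ⟨Matrix.diagonal b, Matrix.diagonal fun i => (b i)⁻¹,
    by simp [Matrix.diagonal_mul_diagonal, mul_inv_cancel₀ (hb.ne_zero _)],
    by simp [Matrix.diagonal_mul_diagonal, inv_mul_cancel₀ (hb.ne_zero _)]⟩
  let N' : Matrix ι ι w.valuationSubring :=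
    Matrix.of fun i j => ⟨b i * algebraMap K L (N i j) * (b j)⁻¹, hle i j⟩
  have hN' : N'.map w.valuationSubring.subtype =
      P.val * N.map (algebraMap K L) * P.val⁻¹ := by
    rw [← Matrix.coe_units_inv]
    ext i j
    simp [N', P]
  have hchar : N.charpoly.map (algebraMap K L) =
      N'.charpoly.map w.valuationSubring.subtype := by
    rw [← Matrix.charpoly_map, ← Matrix.charpoly_map, hN', Matrix.charpoly_units_conj]
  rw [← Polynomial.coeff_map, hchar, Polynomial.coeff_map]
  exact (N'.charpoly.coeff n).2

open Polynomial in
theorem mem_valuationSubring_of_monic [Algebra K L] (B : ValuationSubring L) {z : L} {p : K[X]}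
    (hp : p.Monic) (hz : aeval z p = 0) (hc : ∀ n, algebraMap K L (p.coeff n) ∈ B) : z ∈ B := by
  have hB : B.valuation.Integers B :=
    ⟨Subtype.val_injective, B.valuation_le_one,
      fun r hr => ⟨⟨r, (B.valuation_le_one_iff r).mp hr⟩, rfl⟩⟩
  have hcoeff : (↑(p.map (algebraMap K L)).coeffs : Set L) ⊆ B.toSubring := by
    intro a ha
    obtain ⟨n, -, rfl⟩ := Polynomial.mem_coeffs_iff.mp ha
    rw [Polynomial.coeff_map]
    exact hc n
  have hint : IsIntegral B z := by
    refine ⟨(p.map (algebraMap K L)).toSubring B.toSubring hcoeff,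
      (Polynomial.monic_toSubring _ _ _).mpr (hp.map _), ?_⟩
    rw [Polynomial.eval₂_eq_eval_map]
    have := Polynomial.map_toSubring (p.map (algebraMap K L)) B.toSubring hcoeff
    change Polynomial.eval z (Polynomial.map (Subring.subtype B.toSubring) _) = 0
    rw [this, Polynomial.eval_map_algebraMap, hz]
  exact (B.valuation_le_one_iff z).mp (hB.mem_of_integral hint)

theorem IsValueReps.exists_value_pow_eq [Algebra K L] {ι : Type*} [Finite ι] {w : Valuation L Γ}
    {x : ι → L} (hx : IsValueReps K w x) {z : L} (hz : z ≠ 0) :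
    ∃ (n : ℕ) (a : K), n ≠ 0 ∧ w (z ^ n) = w (algebraMap K L a) := by
  choose i c hc using fun n : ℕ => hx.exists_value_eq (z ^ n) (pow_ne_zero n hz)
  obtain ⟨m, n, hmn, him⟩ : ∃ m n, m < n ∧ i m = i n := by
    obtain ⟨m, n, hne, him⟩ := Finite.exists_ne_map_eq_of_infinite i
    rcases hne.lt_or_gt with h | h
    exacts [⟨m, n, h, him⟩, ⟨n, m, h, him.symm⟩]
  have hm : w (z ^ m) ≠ 0 := (w.ne_zero_iff).mpr (pow_ne_zero m hz)
  have hcx := hc m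
  rw [map_mul] at hcx
  have hcm : w (algebraMap K L (c m)) ≠ 0 := left_ne_zero_of_mul (hcx ▸ hm)
  have hxm : w (x (i n)) ≠ 0 := him ▸ right_ne_zero_of_mul (hcx ▸ hm)
  refine ⟨n - m, c n / c m, (Nat.sub_pos_of_lt hmn).ne', ?_⟩
  have hpow : w (z ^ (n - m)) = w (z ^ n) / w (z ^ m) := by
    rw [eq_div_iff hm, ← map_mul, ← pow_add, Nat.sub_add_cancel hmn.le]
  rw [hpow, hc n, hc m, him, map_div₀, map_div₀, map_mul, map_mul, mul_div_mul_right _ _ hxm]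

theorem eq_valuationSubring_of_comap_eq [Algebra K L] {ι κ : Type*} [Finite ι] [Fintype κ]
    {w : Valuation L Γ} {x : ι → L} (hx : IsValueReps K w x) (b : Module.Basis κ K L)
    (hb : IsValueOrthogonal K w b) {B : ValuationSubring L}
    (hB : B.comap (algebraMap K L) = w.valuationSubring.comap (algebraMap K L)) :
    B = w.valuationSubring := by
  have hmem : ∀ a : K, algebraMap K L a ∈ B ↔ w (algebraMap K L a) ≤ 1 := fun a => by
    rw [← ValuationSubring.mem_comap, hB]
    rfl
  have hle : ∀ z : L, w z ≤ 1 → z ∈ B := fun z hz => by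
    obtain ⟨p, hp, hpz, hpc⟩ := hb.exists_monic_of_value_le_one b hz
    exact mem_valuationSubring_of_monic B hp hpz fun n => (hmem _).mpr (hpc n)
  refine ValuationSubring.ext _ _ fun z => ⟨fun hz => ?_, fun hz => hle z hz⟩
  rcases eq_or_ne z 0 with rfl | h0
  · exact ValuationSubring.zero_mem _
  obtain ⟨n, a, hn, ha⟩ := hx.exists_value_pow_eq h0
  have hzn : w (z ^ n) ≠ 0 := (w.ne_zero_iff).mpr (pow_ne_zero n h0)
  have haB : algebraMap K L a ∈ B := by
    have hu : algebraMap K L a / z ^ n ∈ B := hle _ (by rw [map_div₀, ← ha, div_self hzn])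
    have := B.mul_mem _ _ hu (pow_mem hz n)
    rwa [div_mul_cancel₀ _ (pow_ne_zero n h0)] at this
  rw [hmem, ← ha, map_pow] at haB
  exact (pow_le_one_iff hn).mp haB

section Compositum

variable {K F L FL : Type*} [Field K] [Field F] [Field L] [Field FL] [Algebra K F] [Algebra K L]
  [Algebra K FL] [Algebra F FL] [Algebra L FL] [IsScalarTower K F FL] [IsScalarTower K L FL]
  {w : Valuation FL Γ}

theorem IsValueIndep.baseChange (hF : HasLeadingTerms K (w.comap (algebraMap F FL))) {ι : Type*}
    {x : ι → L} (hx : IsValueIndep K (w.comap (algebraMap L FL)) x) :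
    IsValueIndep F w (fun i => algebraMap L FL (x i)) := by
  refine ⟨fun i => by simpa using hx.ne_zero i, fun i j c hc => ?_⟩
  rcases eq_or_ne c 0 with rfl | h0
  · exact absurd hc (by simpa using hx.ne_zero i)
  obtain ⟨d, hd⟩ := hF c h0
  have hdc := value_eq_of_sub_lt _ hd
  rw [Valuation.comap_apply, Valuation.comap_apply, ← IsScalarTower.algebraMap_apply] at hdc
  refine hx.eq_of_value_eq i j d ?_
  rw [Valuation.comap_apply, Valuation.comap_apply, hc, map_mul, map_mul, map_mul, ← hdc,
    ← IsScalarTower.algebraMap_apply]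

theorem IsResidueIndep.baseChange (hF : HasLeadingTerms K (w.comap (algebraMap F FL)))
    {κ : Type*} [Fintype κ] {y : κ → L}
    (hy : IsResidueIndep K (w.comap (algebraMap L FL)) y) :
    IsResidueIndep F w (fun j => algebraMap L FL (y j)) := by
  refine ⟨hy.le_one, fun c hc hlt j => ?_⟩
  have happrox : ∀ i, ∃ d : K, w (algebraMap F FL (c i) - algebraMap K FL d) < 1 := fun i => by
    rcases eq_or_ne (c i) 0 with h0 | h0
    · exact ⟨0, by simp [h0]⟩
    · obtain ⟨d, hd⟩ := hF (c i) h0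
      rw [Valuation.comap_apply, Valuation.comap_apply, map_sub,
        ← IsScalarTower.algebraMap_apply] at hd
      exact ⟨d, hd.trans_le (hc i)⟩
  choose d hd using happrox
  have hdle : ∀ i, w (algebraMap K FL (d i)) ≤ 1 := fun i => by
    rw [← sub_sub_cancel (algebraMap F FL (c i)) (algebraMap K FL (d i))]
    exact Valuation.map_sub_le w (hc i) (hd i).le
  have hsum : w (∑ i, algebraMap K FL (d i) * algebraMap L FL (y i)) < 1 := by
    have hdiff : w (∑ i, (algebraMap F FL (c i) - algebraMap K FL (d i)) *
        algebraMap L FL (y i)) < 1 := by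
      refine Valuation.map_sum_lt w one_ne_zero fun i _ => ?_
      rw [map_mul]
      exact mul_lt_one_of_lt_of_le (hd i) (hy.le_one i)
    simp only [sub_mul, Finset.sum_sub_distrib] at hdiff
    rw [← sub_sub_cancel (∑ i, algebraMap F FL (c i) * algebraMap L FL (y i))
      (∑ i, algebraMap K FL (d i) * algebraMap L FL (y i))]
    exact Valuation.map_sub_lt w hlt hdiff
  have key := hy.coeff_lt_one d
    (fun i => by simpa [← IsScalarTower.algebraMap_apply] using hdle i)
    (by simpa [← IsScalarTower.algebraMap_apply] using hsum) j
  rw [Valuation.comap_apply, ← IsScalarTower.algebraMap_apply] at key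
  rw [← sub_add_cancel (algebraMap F FL (c j)) (algebraMap K FL (d j))]
  exact Valuation.map_add_lt w (hd j) key

theorem span_range_algebraMap_eq_top [FiniteDimensional K L]
    (hcomp : (algebraMap F FL).fieldRange ⊔ (algebraMap L FL).fieldRange = ⊤) {ι : Type*}
    {b : ι → L} (hb : Submodule.span K (Set.range b) = ⊤) :
    Submodule.span F (Set.range fun k => algebraMap L FL (b k)) = ⊤ := by
  have halg : ∀ z ∈ Set.range (algebraMap L FL), IsAlgebraic F z := by
    rintro _ ⟨l, rfl⟩
    have : IsIntegral K (algebraMap L FL l) :=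
      (Algebra.IsIntegral.isIntegral (R := K) l).map (IsScalarTower.toAlgHom K L FL)
    exact (this.tower_top).isAlgebraic
  have htop : IntermediateField.adjoin F (Set.range (algebraMap L FL)) = ⊤ := by
    refine eq_top_iff.mpr fun z _ => ?_
    have hle : (algebraMap F FL).fieldRange ⊔ (algebraMap L FL).fieldRange ≤
        (IntermediateField.adjoin F (Set.range (algebraMap L FL))).toSubfield := by
      refine sup_le ?_ ?_
      · rintro _ ⟨a, rfl⟩
        exact IntermediateField.algebraMap_mem _ a
      · rintro _ ⟨l, rfl⟩
        exact IntermediateField.subset_adjoin F _ ⟨l, rfl⟩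
    rw [hcomp] at hle
    exact hle (Subfield.mem_top z)
  rw [IntermediateField.adjoin_eq_top_iff_of_isAlgebraic halg] at htop
  have hclosure : Submonoid.closure (Set.range (algebraMap L FL)) =
      MonoidHom.mrange (algebraMap L FL : L →* FL) := by
    rw [← Submonoid.closure_eq (MonoidHom.mrange (algebraMap L FL : L →* FL))]
    rfl
  have hspan := Algebra.adjoin_eq_span F (Set.range (algebraMap L FL))
  rw [htop, Algebra.top_toSubmodule, hclosure] at hspan
  rw [hspan, eq_comm]
  refine le_antisymm (Submodule.span_le.mpr ?_) (Submodule.span_mono ?_)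
  · rintro _ ⟨l, rfl⟩
    have hl : l ∈ Submodule.span K (Set.range b) := hb ▸ Submodule.mem_top
    change algebraMap L FL l ∈ _
    induction hl using Submodule.span_induction with
    | mem t ht =>
      obtain ⟨k, rfl⟩ := ht
      exact Submodule.subset_span ⟨k, rfl⟩
    | zero => rw [map_zero]; exact Submodule.zero_mem _
    | add s t _ _ hs ht => rw [map_add]; exact Submodule.add_mem _ hs ht
    | smul a t _ ht =>
      have : algebraMap L FL (a • t) = algebraMap K F a • algebraMap L FL t := by
        rw [Algebra.smul_def, Algebra.smul_def, map_mul, ← IsScalarTower.algebraMap_apply,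
          ← IsScalarTower.algebraMap_apply]
      rw [this]
      exact Submodule.smul_mem _ _ ht
  · rintro _ ⟨k, rfl⟩
    exact ⟨b k, rfl⟩

theorem IsValueOrthogonal.hasLeadingTerms
    (hF : HasLeadingTerms K (w.comap (algebraMap F FL))) {ι : Type*} [Fintype ι] {b : ι → L}
    (hb : IsValueOrthogonal F w (fun k => algebraMap L FL (b k)))
    (hspan : Submodule.span F (Set.range fun k => algebraMap L FL (b k)) = ⊤) :
    HasLeadingTerms L w := by
  intro z hz
  have hwz : 0 < w z := zero_lt_iff.mpr ((w.ne_zero_iff).mpr hz)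
  obtain ⟨c, hc⟩ := (Submodule.mem_span_range_iff_exists_fun F).mp
    (hspan ▸ Submodule.mem_top (x := z))
  simp only [Algebra.smul_def] at hc
  have happrox : ∀ k, ∃ d : K,
      w ((algebraMap F FL (c k) - algebraMap K FL d) * algebraMap L FL (b k)) < w z := fun k => by
    rcases eq_or_ne (c k) 0 with h0 | h0
    · exact ⟨0, by simpa [h0] using hwz⟩
    · obtain ⟨d, hd⟩ := hF (c k) h0
      rw [Valuation.comap_apply, Valuation.comap_apply, map_sub,
        ← IsScalarTower.algebraMap_apply] at hd
      refine ⟨d, lt_of_lt_of_le ?_ (hc ▸ hb.value_le_value_sum c k)⟩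
      rw [map_mul, map_mul]
      exact mul_lt_mul_of_pos_right hd (zero_lt_iff.mpr ((w.ne_zero_iff).mpr (hb.ne_zero k)))
  choose d hd using happrox
  refine ⟨∑ k, algebraMap K L (d k) * b k, ?_⟩
  have hdiff : z - algebraMap L FL (∑ k, algebraMap K L (d k) * b k) =
      ∑ k, (algebraMap F FL (c k) - algebraMap K FL (d k)) * algebraMap L FL (b k) := by
    simp only [← hc, sub_mul, Finset.sum_sub_distrib, map_sum, map_mul,
      ← IsScalarTower.algebraMap_apply]
  rw [hdiff]
  exact Valuation.map_sum_lt' w hwz fun k _ => hd k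

theorem IsValueReps.baseChange (hF : HasLeadingTerms K (w.comap (algebraMap F FL)))
    (hL : HasLeadingTerms L w) {ι : Type*} {x : ι → L}
    (hx : IsValueReps K (w.comap (algebraMap L FL)) x) :
    IsValueReps F w (fun i => algebraMap L FL (x i)) := by
  refine ⟨hx.toIsValueIndep.baseChange hF, fun z hz => ?_⟩
  obtain ⟨l, hl⟩ := hL z hz
  have hlz := value_eq_of_sub_lt w hl
  have hl0 : l ≠ 0 := by
    rintro rfl
    rw [map_zero, map_zero, eq_comm, w.zero_iff] at hlz
    exact hz hlz
  obtain ⟨i, c, hc⟩ := hx.exists_value_eq l hl0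
  refine ⟨i, algebraMap K F c, ?_⟩
  rwa [Valuation.comap_apply, Valuation.comap_apply, map_mul (algebraMap L FL),
    ← IsScalarTower.algebraMap_apply, hlz, IsScalarTower.algebraMap_apply K F FL] at hc

theorem IsResidueBasis.baseChange (hF : HasLeadingTerms K (w.comap (algebraMap F FL)))
    (hL : HasLeadingTerms L w) {κ : Type*} [Fintype κ] {y : κ → L}
    (hy : IsResidueBasis K (w.comap (algebraMap L FL)) y) :
    IsResidueBasis F w (fun j => algebraMap L FL (y j)) := by
  refine ⟨hy.toIsResidueIndep.baseChange hF, fun z hz => ?_⟩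
  rcases eq_or_ne z 0 with rfl | h0
  · exact ⟨0, by simp, by simp⟩
  obtain ⟨l, hl⟩ := hL z h0
  have hlz := value_eq_of_sub_lt w hl
  obtain ⟨c, hc, hlt⟩ := hy.exists_approx l (hlz.trans_le hz)
  simp only [Valuation.comap_apply, map_sub, map_sum, map_mul,
    ← IsScalarTower.algebraMap_apply] at hc hlt
  refine ⟨fun j => algebraMap K F (c j), fun j => ?_, ?_⟩
  · rw [← IsScalarTower.algebraMap_apply]
    exact hc j
  · simp only [← IsScalarTower.algebraMap_apply]
    rw [← sub_add_sub_cancel z (algebraMap L FL l)]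
    exact Valuation.map_add_lt w (hl.trans_le hz) hlt

end Compositum

end ValuationBasis

/-- If `(F|K,v)` is immediate and `(L|K,v)` is finite defectless with unique extension of the
valuation, then `(F.L|F)` is finite defectless with unique extension, `(F.L|L)` is immediate,
and `[F.L : F] = [L : K]`. -/
theorem statement15 {K F L FL M : Type u} [Field K] [Field F] [Field L] [Field FL] [Field M]
    [Algebra K F] [Algebra K L] [Algebra K FL] [Algebra K M]
    [Algebra F FL] [Algebra L FL] [Algebra F M] [Algebra L M] [Algebra FL M]
    [IsScalarTower K F FL] [IsScalarTower K L FL] [IsScalarTower K FL M]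
    [IsScalarTower F FL M] [IsScalarTower L FL M]
    [IsScalarTower K F M] [IsScalarTower K L M]
    (hcomp : (algebraMap F FL).fieldRange ⊔ (algebraMap L FL).fieldRange = ⊤)
    (D : ValuationSubring M)
    (himm : IsImmediate K (D.comap (algebraMap F M)))
    [FiniteDimensional K L]
    (hdl : IsDefectless (D.comap (algebraMap K M)) (D.comap (algebraMap L M)))
    (huniq : ∀ B B' : ValuationSubring L,
      B.comap (algebraMap K L) = D.comap (algebraMap K M) →
      B'.comap (algebraMap K L) = D.comap (algebraMap K M) → B = B') :
    FiniteDimensional F FL ∧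
    IsDefectless (D.comap (algebraMap F M)) (D.comap (algebraMap FL M)) ∧
    (∀ B B' : ValuationSubring FL,
      B.comap (algebraMap F FL) = D.comap (algebraMap F M) →
      B'.comap (algebraMap F FL) = D.comap (algebraMap F M) → B = B') ∧
    IsImmediate L (D.comap (algebraMap FL M)) ∧
    Module.finrank F FL = Module.finrank K L := by

  set w : Valuation FL D.ValueGroup := D.valuation.comap (algebraMap FL M) with hw
  have hcomap : ∀ (E : Type u) [Field E] [Algebra E FL] [Algebra E M] [IsScalarTower E FL M],
      D.comap (algebraMap E M) = (w.comap (algebraMap E FL)).valuationSubring :=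
    fun E _ _ _ _ => ValuationSubring.ext _ _ fun z => by
      rw [ValuationSubring.mem_comap, Valuation.mem_valuationSubring_iff, Valuation.comap_apply,
        hw, Valuation.comap_apply, ← IsScalarTower.algebraMap_apply,
        ValuationSubring.valuation_le_one_iff]
  have hFL : D.comap (algebraMap FL M) = w.valuationSubring := hcomap FL
  have hK : (w.comap (algebraMap L FL)).valuationSubring.comap (algebraMap K L) =
      D.comap (algebraMap K M) := by
    rw [← hcomap L, ValuationSubring.comap_comap, ← IsScalarTower.algebraMap_eq]
  have hA : w.valuationSubring.comap (algebraMap F FL) = D.comap (algebraMap F M) := by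
    rw [hcomap F]
    rfl
  rw [hcomap F, isImmediate_iff_hasLeadingTerms] at himm
  rw [IsDefectless, hcomap L] at hdl
  have hpos : 0 < Module.finrank K L := Module.finrank_pos
  obtain ⟨x, hx⟩ := exists_isValueReps (w.comap (algebraMap L FL))
    (left_ne_zero_of_mul (hdl ▸ hpos.ne'))
  obtain ⟨f, y, hy⟩ := exists_isResidueBasis (w.comap (algebraMap L FL)) hK
    (right_ne_zero_of_mul (hdl ▸ hpos.ne'))
  have hcard : Fintype.card (Fin (ramIndex K (w.comap (algebraMap L FL)).valuationSubring) ×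
      Fin f) = Module.finrank K L := by
    rw [hdl, Fintype.card_prod, Fintype.card_fin, hy.residueDegree_eq hK]
  have hli := (hx.isValueOrthogonal_mul hy.toIsResidueIndep).linearIndependent
  have hspan := span_range_algebraMap_eq_top hcomp (hli.span_eq_top_of_card_eq_finrank' hcard)
  have horth : IsValueOrthogonal F w
      (fun k : Fin _ × Fin f => algebraMap L FL (x k.1 * y k.2)) := by
    simpa only [map_mul] using (hx.toIsValueIndep.baseChange himm).isValueOrthogonal_mul
      (hy.toIsResidueIndep.baseChange himm)
  have hL : HasLeadingTerms L w := horth.hasLeadingTerms himm hspan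
  have hx' := hx.baseChange himm hL
  have hy' := hy.baseChange himm hL
  let b := Module.Basis.mk horth.linearIndependent hspan.ge
  have hb : IsValueOrthogonal F w b := by
    rw [Module.Basis.coe_mk]
    exact horth
  have hrank : Module.finrank F FL = Module.finrank K L := by
    rw [Module.finrank_eq_card_basis b, hcard]
  refine ⟨Module.Basis.finiteDimensional_of_finite b, ?_, fun B B' hB hB' => ?_, ?_, hrank⟩
  · rw [IsDefectless, hFL, hx'.ramIndex_eq, hy'.residueDegree_eq hA,
      Module.finrank_eq_card_basis b, Fintype.card_prod]
  · rw [← hA] at hB hB'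
    rw [eq_valuationSubring_of_comap_eq hx' b hb hB, eq_valuationSubring_of_comap_eq hx' b hb hB']
  · rw [hFL, isImmediate_iff_hasLeadingTerms]
    exact hL

end ValuedDefect
end
end

section
/- Let (K,v) be a valued field of characteristic p>0, and extend v (uniquely) to the perfect hull of K. Then the following are equivalent: (i) (K,v) is inseparably defectless; (ii) the extension (K^{1/p}|K,v) is defectless, where K^{1/p} = {x in the perfect hull : x^p ∈ K}; (iii) the extension (K|K^p,v) is defectless, where K^p is the image of K under the Frobenius x ↦ x^p and v is restricted to K^p. -/
open scoped Classical

noncomputable section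

namespace ValuedDefect

universe u v

variable {K : Type u} {L : Type v} [Field K] [Field L]

/-- A finite family of nonzero elements is valuation independent over `K` if the value of each
linear combination is the extreme one among the values of its terms. -/
def ValIndep (K : Type*) {L : Type*} [Field K] [Field L] [Algebra K L]
    (B : ValuationSubring L) {ι : Type*} [Fintype ι] (u : ι → L) : Prop :=
  (∀ i, u i ≠ 0) ∧
    ∀ (c : ι → K) (i : ι), B.valuation (c i • u i) ≤ B.valuation (∑ j, c j • u j)

theorem ValIndep.linearIndependent [Algebra K L] {B : ValuationSubring L} {ι : Type*} [Fintype ι]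
    {u : ι → L} (hu : ValIndep K B u) : LinearIndependent K u := by
  rw [Fintype.linearIndependent_iff]
  intro g hg i
  have h := hu.2 g i
  rw [hg, map_zero, le_zero_iff, map_eq_zero] at h
  exact (smul_eq_zero.mp h).resolve_right (hu.1 i)

theorem ValIndep.comp_injective [Algebra K L] {B : ValuationSubring L} {ι κ : Type*} [Fintype ι]
    [Fintype κ] {u : ι → L} (hu : ValIndep K B u) {f : κ → ι} (hf : Function.Injective f) :
    ValIndep K B (u ∘ f) := by
  refine ⟨fun i => hu.1 _, fun c i => ?_⟩
  have h := hu.2 (Function.extend f c 0) (f i)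
  rw [hf.extend_apply] at h
  refine h.trans (le_of_eq (congrArg _ ?_))
  rw [← Finset.sum_subset (Finset.subset_univ (Finset.univ.image f)),
    Finset.sum_image hf.injOn]
  · simp [hf.extend_apply]
  · intro j _ hj
    rw [Function.extend_apply', Pi.zero_apply, zero_smul]
    rintro ⟨k, rfl⟩
    exact hj (Finset.mem_image_of_mem f (Finset.mem_univ k))

theorem ValIndep.cons [Algebra K L] {B : ValuationSubring L} {n : ℕ} {u : Fin n → L}
    (hu : ValIndep K B u) {w : L} (hw : w ≠ 0)
    (h : ∀ a : K, ∀ y ∈ Submodule.span K (Set.range u),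
      B.valuation (a • w) ≤ B.valuation (a • w + y)) :
    ValIndep K B (Fin.cons w u : Fin (n + 1) → L) := by
  refine ⟨Fin.cases hw hu.1, fun c i => ?_⟩
  have hy : ∑ j, c (Fin.succ j) • u j ∈ Submodule.span K (Set.range u) :=
    Submodule.sum_mem _ fun j _ => Submodule.smul_mem _ _ (Submodule.subset_span ⟨j, rfl⟩)
  rw [Fin.sum_univ_succ]
  simp only [Fin.cons_zero, Fin.cons_succ]
  have h0 := h (c 0) _ hy
  refine Fin.cases (by simpa using h0) (fun i => ?_) i
  rw [Fin.cons_succ]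
  refine (hu.2 (fun j => c j.succ) i).trans ?_
  have := B.valuation.map_sub (c 0 • w + ∑ j, c (Fin.succ j) • u j) (c 0 • w)
  rw [add_sub_cancel_left, max_eq_left h0] at this
  exact this

theorem ValIndep.exists_of_le_span_image [Algebra K L] {B : ValuationSubring L} {ι : Type*}
    [Fintype ι] {u : ι → L} (hu : ValIndep K B u) (t : Finset ι) :
    ∀ V : Submodule K L, V ≤ Submodule.span K (u '' t) →
      ∃ (n : ℕ) (w : Fin n → L), ValIndep K B w ∧ Submodule.span K (Set.range w) = V := by
  induction t using Finset.strongInduction with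
  | H t ih =>
  intro V hV
  by_cases hbot : V = ⊥
  · exact ⟨0, Fin.elim0, ⟨fun i => i.elim0, fun _ i => i.elim0⟩, by simp [hbot]⟩
  obtain ⟨w, hwV, hw0⟩ := V.ne_bot_iff.mp hbot
  have hrep : ∀ (s : Finset ι) (y : L), y ∈ Submodule.span K (u '' s) →
      ∃ c : ι → K, (∀ i, i ∉ s → c i = 0) ∧ ∑ i, c i • u i = y := by
    intro s y hy
    obtain ⟨c, hc⟩ := (Submodule.mem_span_image_finset_iff_exists_fun' K).mp hy
    refine ⟨fun i => if i ∈ s then c i else 0, fun i hi => if_neg hi, ?_⟩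
    simp [ite_smul, Finset.sum_ite_mem, hc]
  obtain ⟨c, hct, hcw⟩ := hrep t w (hV hwV)
  have hne : (Finset.univ : Finset ι).Nonempty := by
    by_contra hempty
    rw [Finset.not_nonempty_iff_eq_empty] at hempty
    rw [hempty, Finset.sum_empty] at hcw
    exact hw0 hcw.symm
  obtain ⟨i₀, -, hi₀⟩ := Finset.exists_max_image Finset.univ
    (fun i => B.valuation (c i • u i)) hne
  have hwle : B.valuation w ≤ B.valuation (c i₀ • u i₀) := by
    rw [← hcw]
    exact B.valuation.map_sum_le hi₀
  have hc0 : c i₀ ≠ 0 := by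
    intro h0
    rw [h0, zero_smul, map_zero, le_zero_iff, map_eq_zero] at hwle
    exact hw0 hwle
  have hmem : i₀ ∈ t := by
    by_contra h
    exact hc0 (hct i₀ h)
  obtain ⟨n, w', hw', hspan⟩ := ih (t.erase i₀) (Finset.erase_ssubset hmem)
    (V ⊓ Submodule.span K (u '' (t.erase i₀ : Finset ι))) inf_le_right
  refine ⟨n + 1, Fin.cons w w', hw'.cons hw0 fun a y hy => ?_, le_antisymm ?_ fun x hx => ?_⟩
  · rw [hspan] at hy
    obtain ⟨d, hdt, rfl⟩ := hrep _ y hy.2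
    rw [← hcw, Finset.smul_sum, ← Finset.sum_add_distrib]
    simp_rw [smul_smul, ← add_smul]
    refine le_trans ?_ (hu.2 (fun i => a * c i + d i) i₀)
    rw [hdt i₀ (Finset.notMem_erase _ _), add_zero]
    simp_rw [mul_smul]
    rw [← Finset.smul_sum, hcw, Algebra.smul_def, Algebra.smul_def a (c i₀ • u i₀), map_mul,
      map_mul]
    gcongr
  · rw [Fin.range_cons, Submodule.span_le, Set.insert_subset_iff]
    refine ⟨hwV, fun x hx => ?_⟩
    have := Submodule.subset_span (R := K) hx
    rw [hspan] at this
    exact this.1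
  · obtain ⟨e, het, hex⟩ := hrep t x (hV hx)
    have hx' : x - (e i₀ / c i₀) • w ∈ Submodule.span K (Set.range w') := by
      rw [hspan]
      refine ⟨V.sub_mem hx (V.smul_mem _ hwV), ?_⟩
      rw [← hex, ← hcw, Finset.smul_sum, ← Finset.sum_sub_distrib]
      refine Submodule.sum_mem _ fun i _ => ?_
      rw [smul_smul, ← sub_smul]
      by_cases hi : i ∈ t.erase i₀
      · exact Submodule.smul_mem _ _ (Submodule.subset_span ⟨i, hi, rfl⟩)
      · have hz : e i - e i₀ / c i₀ * c i = 0 := by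
          by_cases h : i = i₀
          · rw [h, div_mul_cancel₀ _ hc0, sub_self]
          · have hit : i ∉ t := fun hit => hi (Finset.mem_erase.mpr ⟨h, hit⟩)
            rw [het i hit, hct i hit, mul_zero, sub_zero]
        rw [hz, zero_smul]
        exact Submodule.zero_mem _
    rw [Fin.range_cons, Submodule.span_insert, Submodule.mem_sup]
    exact ⟨_, Submodule.smul_mem _ (e i₀ / c i₀) (Submodule.mem_span_singleton_self w), _, hx',
      by abel⟩

/-- Subspaces of a space with a valuation basis have a valuation basis. -/
theorem ValIndep.exists_of_le_span [Algebra K L] {B : ValuationSubring L} {ι : Type*}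
    [Fintype ι] {u : ι → L} (hu : ValIndep K B u) {V : Submodule K L}
    (hV : V ≤ Submodule.span K (Set.range u)) :
    ∃ (n : ℕ) (w : Fin n → L), ValIndep K B w ∧ Submodule.span K (Set.range w) = V :=
  hu.exists_of_le_span_image Finset.univ V (by simpa using hV)

/-- The units of `L` whose value lies in the value group of `K`. -/
def valueSubgroup (K : Type*) {L : Type*} [Field K] [Field L] [Algebra K L]
    (B : ValuationSubring L) : Subgroup Lˣ :=
  MonoidHom.range (Units.map (algebraMap K L).toMonoidHom) ⊔ B.unitGroup

theorem ramIndex_eq_index [Algebra K L] (B : ValuationSubring L) :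
    ramIndex K B = (valueSubgroup K B).index := by
  rw [ramIndex, Subgroup.index_map, QuotientGroup.ker_mk',
    MonoidHom.range_eq_top_of_surjective _ (QuotientGroup.mk'_surjective _), Subgroup.index_top,
    mul_one, valueSubgroup]

theorem mem_valueSubgroup_iff [Algebra K L] {B : ValuationSubring L} {x : Lˣ} :
    x ∈ valueSubgroup K B ↔ ∃ c : K, B.valuation x = B.valuation (algebraMap K L c) := by
  rw [valueSubgroup, Subgroup.mem_sup]
  constructor
  · rintro ⟨_, ⟨c, rfl⟩, z, hz, rfl⟩
    rw [ValuationSubring.mem_unitGroup_iff] at hz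
    exact ⟨c, by rw [Units.val_mul, map_mul, hz, mul_one]; rfl⟩
  · rintro ⟨c, hc⟩
    have hc0 : c ≠ 0 := by
      rintro rfl
      rw [map_zero, map_zero, map_eq_zero] at hc
      exact x.ne_zero hc
    refine ⟨_, ⟨Units.mk0 c hc0, rfl⟩, (Units.map (algebraMap K L).toMonoidHom (Units.mk0 c hc0))⁻¹
      * x, ?_, mul_inv_cancel_left _ _⟩
    rw [ValuationSubring.mem_unitGroup_iff, Units.val_mul, map_mul, hc, ← map_mul]
    simp [hc0]

/-- A finite family of integral elements with residues linearly independent over `Kv`. -/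
def ResIndep (K : Type*) {L : Type*} [Field K] [Field L] [Algebra K L]
    (B : ValuationSubring L) {κ : Type*} [Fintype κ] (y : κ → L) : Prop :=
  (∀ j, B.valuation (y j) ≤ 1) ∧
    ∀ a : κ → K, (∀ j, B.valuation (algebraMap K L (a j)) ≤ 1) →
      B.valuation (∑ j, a j • y j) < 1 → ∀ j, B.valuation (algebraMap K L (a j)) < 1

theorem ResIndep.valuation_le [Algebra K L] {B : ValuationSubring L} {κ : Type*} [Fintype κ]
    {y : κ → L} (hy : ResIndep K B y) (c : κ → K) (j : κ) :
    B.valuation (algebraMap K L (c j)) ≤ B.valuation (∑ j, c j • y j) := by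
  obtain ⟨j₀, -, hj₀⟩ := Finset.exists_max_image Finset.univ
    (fun i => B.valuation (algebraMap K L (c i))) ⟨j, Finset.mem_univ j⟩
  refine (hj₀ j (Finset.mem_univ j)).trans ?_
  by_cases h0 : c j₀ = 0
  · simp [h0]
  have hv0 : 0 < B.valuation (algebraMap K L (c j₀)) := by simpa [zero_lt_iff] using h0
  by_contra! hlt
  have h1 := hy.2 (fun j => (c j₀)⁻¹ * c j) (fun j => ?_) ?_ j₀
  · simp [h0] at h1
  · rw [map_mul, map_mul, map_inv₀, map_inv₀, inv_mul_le_iff₀ hv0, mul_one]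
    exact hj₀ j (Finset.mem_univ j)
  · simp_rw [mul_smul]
    rw [← Finset.smul_sum, Algebra.smul_def, map_mul, map_inv₀, map_inv₀, inv_mul_lt_iff₀ hv0,
      mul_one]
    exact hlt

theorem ResIndep.exists_valuation_eq [Algebra K L] {B : ValuationSubring L} {κ : Type*}
    [Fintype κ] {y : κ → L} (hy : ResIndep K B y) (c : κ → K) :
    ∃ d : K, B.valuation (∑ j, c j • y j) = B.valuation (algebraMap K L d) := by
  rcases isEmpty_or_nonempty κ with hκ | hκ
  · exact ⟨0, by simp⟩
  obtain ⟨j₀, -, hj₀⟩ := Finset.exists_max_image Finset.univ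
    (fun i => B.valuation (algebraMap K L (c i))) Finset.univ_nonempty
  refine ⟨c j₀, le_antisymm (B.valuation.map_sum_le fun j hj => ?_) (hy.valuation_le c j₀)⟩
  rw [Algebra.smul_def, map_mul]
  exact (mul_le_of_le_one_right' (hy.1 j)).trans (hj₀ j hj)

theorem valuation_le_valuation_sum (B : ValuationSubring L) {ι : Type*} [Fintype ι] (f : ι → L)
    (hf : ∀ i j, f i ≠ 0 → f j ≠ 0 → B.valuation (f i) = B.valuation (f j) → i = j) (i : ι) :
    B.valuation (f i) ≤ B.valuation (∑ j, f j) := by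
  obtain ⟨i₀, -, hi₀⟩ := Finset.exists_max_image Finset.univ
    (fun i => B.valuation (f i)) ⟨i, Finset.mem_univ i⟩
  refine (hi₀ i (Finset.mem_univ i)).trans ?_
  by_cases h0 : f i₀ = 0
  · simp [h0]
  have hlt : B.valuation (∑ j ∈ Finset.univ.erase i₀, f j) < B.valuation (f i₀) := by
    refine B.valuation.map_sum_lt (by simpa using h0) fun j hj => ?_
    refine lt_of_le_of_ne (hi₀ j (Finset.mem_univ j)) fun heq => ?_
    have hj0 : f j ≠ 0 := by
      intro hj0
      rw [hj0, map_zero, eq_comm, map_eq_zero] at heq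
      exact h0 heq
    exact Finset.ne_of_mem_erase hj (hf j i₀ hj0 h0 heq)
  rw [← Finset.add_sum_erase _ _ (Finset.mem_univ i₀), Valuation.map_add_eq_of_lt_left _ hlt]

theorem valIndep_mul [Algebra K L] {B : ValuationSubring L} {ι κ : Type*} [Fintype ι] [Fintype κ]
    {x : ι → Lˣ} {y : κ → L}
    (hx : Function.Injective fun i => (QuotientGroup.mk (x i) : Lˣ ⧸ valueSubgroup K B))
    (hy : ResIndep K B y) : ValIndep K B fun ij : ι × κ => (x ij.1 : L) * y ij.2 := by
  refine ⟨fun ij => mul_ne_zero (x ij.1).ne_zero fun h0 => ?_, fun c ij => ?_⟩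
  · have h := hy.valuation_le (Pi.single ij.2 1) ij.2
    rw [Finset.sum_eq_single ij.2 (fun j _ hj => by rw [Pi.single_eq_of_ne hj, zero_smul])
      (by simp), h0] at h
    simp at h
  have hsum : ∑ ij : ι × κ, c ij • ((x ij.1 : L) * y ij.2) =
      ∑ i, (x i : L) * ∑ j, c (i, j) • y j := by
    rw [Fintype.sum_prod_type]
    simp_rw [Finset.mul_sum, mul_smul_comm]
  have h1 := valuation_le_valuation_sum B (fun i => (x i : L) * ∑ j, c (i, j) • y j)
    (fun i i' hi hi' heq => ?_) ij.1
  · rw [hsum]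
    refine le_trans ?_ h1
    rw [Algebra.smul_def, mul_left_comm, map_mul, map_mul, map_mul]
    gcongr
    exact (mul_le_of_le_one_right' (hy.1 ij.2)).trans
      (hy.valuation_le (fun j => c (ij.1, j)) ij.2)
  · apply hx
    refine QuotientGroup.eq.mpr (mem_valueSubgroup_iff.mpr ?_)
    obtain ⟨d, hd⟩ := hy.exists_valuation_eq fun j => c (i, j)
    obtain ⟨d', hd'⟩ := hy.exists_valuation_eq fun j => c (i', j)
    refine ⟨d / d', ?_⟩
    have hi0 := right_ne_zero_of_mul hi'
    rw [← map_ne_zero B.valuation, hd'] at hi0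
    rw [map_mul, map_mul, hd, hd'] at heq
    rw [Units.val_mul, map_mul, Units.val_inv_eq_inv_val, map_inv₀, map_div₀, map_div₀,
      eq_div_iff hi0, mul_assoc, ← heq, inv_mul_cancel_left₀]
    simp

theorem linearIndependent_residue_iff [Algebra K L] (A : ValuationSubring K)
    (B : ValuationSubring L) (h : B.comap (algebraMap K L) = A) {κ : Type*} [Fintype κ]
    (y : κ → B) :
    letI := valHom_isLocalHom A B h
    letI := (IsLocalRing.ResidueField.map (valHom A B h)).toAlgebra
    LinearIndependent (IsLocalRing.ResidueField A) (fun j => IsLocalRing.residue B (y j)) ↔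
      ResIndep K B (fun j => (y j : L)) := by
  let := valHom_isLocalHom A B h
  let := (IsLocalRing.ResidueField.map (valHom A B h)).toAlgebra
  have hsum : ∀ a : κ → A, ∑ j, IsLocalRing.residue A (a j) • IsLocalRing.residue B (y j) = 0 ↔
      B.valuation (∑ j, (a j : K) • (y j : L)) < 1 := by
    intro a
    have : ∑ j, IsLocalRing.residue A (a j) • IsLocalRing.residue B (y j) =
        IsLocalRing.residue B (∑ j, valHom A B h (a j) * y j) := by
      rw [map_sum]
      refine Finset.sum_congr rfl fun j _ => ?_
      rw [Algebra.smul_def, map_mul]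
      rfl
    rw [this, IsLocalRing.residue_eq_zero_iff, ValuationSubring.valuation_lt_one_iff]
    refine Eq.to_iff (congrArg (fun z => B.valuation z < 1) ?_)
    simp [Algebra.smul_def, valHom]
  have hone : ∀ a : A, IsLocalRing.residue A a = 0 ↔ B.valuation (algebraMap K L a) < 1 := by
    intro a
    rw [← map_eq_zero (IsLocalRing.ResidueField.map (valHom A B h)),
      IsLocalRing.ResidueField.map_residue, IsLocalRing.residue_eq_zero_iff,
      ValuationSubring.valuation_lt_one_iff]
    rfl
  rw [Fintype.linearIndependent_iff]
  constructor
  · refine fun hli => ⟨fun j => B.valuation_le_one (y j), fun a ha hlt j => ?_⟩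
    have haA : ∀ j, a j ∈ A := fun j => by
      rw [← h, ValuationSubring.mem_comap]
      exact B.mem_of_valuation_le_one _ (ha j)
    exact (hone ⟨a j, haA j⟩).mp (hli _ ((hsum fun j => ⟨a j, haA j⟩).mpr hlt) j)
  · intro hy g hg j
    choose a ha using fun j => IsLocalRing.residue_surjective (R := A) (g j)
    obtain rfl : g = fun j => IsLocalRing.residue A (a j) := funext fun j => (ha j).symm
    refine (hone (a j)).mpr (hy.2 (fun j => (a j : K)) (fun j => ?_) ((hsum a).mp hg) j)
    exact B.valuation_le_one (valHom A B h (a j))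

theorem ValIndep.exists_fin [Algebra K L] {B : ValuationSubring L} {ι : Type*} [Fintype ι]
    {u : ι → L} (hu : ValIndep K B u) :
    ∃ (n : ℕ) (w : Fin n → L), ValIndep K B w ∧ Set.range w = Set.range u :=
  ⟨Fintype.card ι, u ∘ (Fintype.equivFin ι).symm, hu.comp_injective (Equiv.injective _),
    (Fintype.equivFin ι).symm.surjective.range_comp u⟩

theorem resIndep_one [Algebra K L] (B : ValuationSubring L) :
    ResIndep K B (fun _ : Unit => (1 : L)) := by
  refine ⟨fun _ => by simp, fun a _ hlt j => ?_⟩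
  simpa [Algebra.smul_def] using hlt

theorem finite_quotient_valueSubgroup [Algebra K L] [FiniteDimensional K L]
    (B : ValuationSubring L) : Finite (Lˣ ⧸ valueSubgroup K B) := by
  by_contra hinf
  rw [not_finite_iff_infinite] at hinf
  let g : Fin (Module.finrank K L + 1) → Lˣ ⧸ valueSubgroup K B :=
    fun i => Infinite.natEmbedding _ (i : ℕ)
  have hg : Function.Injective g := fun i j hij =>
    Fin.ext ((Infinite.natEmbedding _).injective hij)
  have h := (valIndep_mul (K := K) (x := fun i => (g i).out) (fun i j hij => hg (by simpa using hij))
    (resIndep_one B)).linearIndependent.fintype_card_le_finrank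
  simp at h

theorem exists_resIndep [Algebra K L] (A : ValuationSubring K) (B : ValuationSubring L)
    (h : B.comap (algebraMap K L) = A) {κ : Type*} [Fintype κ]
    {b : κ → IsLocalRing.ResidueField B} :
    letI := valHom_isLocalHom A B h
    letI := (IsLocalRing.ResidueField.map (valHom A B h)).toAlgebra
    LinearIndependent (IsLocalRing.ResidueField A) b → ∃ y : κ → L, ResIndep K B y := by
  intro hb
  choose y hy using fun j => IsLocalRing.residue_surjective (R := B) (b j)
  exact ⟨_, (linearIndependent_residue_iff A B h y).mp (by simpa only [hy] using hb)⟩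

theorem ValIndep.exists_resIndep_fiber [Algebra K L] {B : ValuationSubring L} {ι : Type*}
    [Fintype ι] {u : ι → L} (hu : ValIndep K B u) (i₀ : ι)
    (h : ∀ i, (QuotientGroup.mk (Units.mk0 (u i₀) (hu.1 i₀)) : Lˣ ⧸ valueSubgroup K B) =
      QuotientGroup.mk (Units.mk0 (u i) (hu.1 i))) :
    ∃ y : ι → L, ResIndep K B y := by
  have hex : ∀ i, ∃ c : K, B.valuation (u i) = B.valuation (algebraMap K L c * u i₀) := by
    intro i
    obtain ⟨c, hc⟩ := mem_valueSubgroup_iff.mp (QuotientGroup.eq.mp (h i))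
    refine ⟨c, ?_⟩
    have h0 : B.valuation (u i₀) ≠ 0 := by simpa using hu.1 i₀
    rw [map_mul, ← hc, Units.val_mul, Units.val_inv_eq_inv_val, map_mul, map_inv₀, Units.val_mk0,
      Units.val_mk0, mul_comm, mul_inv_cancel_left₀ h0]
  choose c hc using hex
  have hc0 : ∀ i, c i ≠ 0 := by
    intro i h0
    have := hc i
    rw [h0, map_zero, zero_mul, map_zero, map_eq_zero] at this
    exact hu.1 i this
  have h0 : 0 < B.valuation (u i₀) := by simpa [zero_lt_iff] using hu.1 i₀
  have hone : ∀ i, B.valuation ((c i)⁻¹ • u i / u i₀) = 1 := by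
    intro i
    have := hc0 i
    have := hu.1 i₀
    rw [map_div₀, Algebra.smul_def, map_mul, hc i, ← map_mul, ← map_div₀]
    simp [*]
  refine ⟨fun i => (c i)⁻¹ • u i / u i₀, fun i => (hone i).le, fun a _ hlt i => ?_⟩
  have hsum : ∑ j, a j • ((c j)⁻¹ • u j / u i₀) = (∑ j, (a j * (c j)⁻¹) • u j) / u i₀ := by
    rw [Finset.sum_div]
    exact Finset.sum_congr rfl fun j _ => by rw [mul_smul, smul_div_assoc, smul_div_assoc, smul_div_assoc]
  rw [hsum, map_div₀, div_lt_one₀ h0] at hlt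
  have hi := (hu.2 (fun j => a j * (c j)⁻¹) i).trans_lt hlt
  rw [← div_lt_one₀ h0, ← map_div₀, mul_smul, smul_div_assoc, Algebra.smul_def, map_mul, hone,
    mul_one] at hi
  exact hi

/-- A finite extension is defectless if and only if it has a valuation basis. -/
theorem isDefectless_iff [Algebra K L] [FiniteDimensional K L] (A : ValuationSubring K)
    (B : ValuationSubring L) (h : B.comap (algebraMap K L) = A) :
    IsDefectless A B ↔ ∃ (n : ℕ) (u : Fin n → L), ValIndep K B u ∧
      Submodule.span K (Set.range u) = ⊤ := by
  let := valHom_isLocalHom A B h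
  let := (IsLocalRing.ResidueField.map (valHom A B h)).toAlgebra
  have hres : residueDegree A B = Module.finrank (IsLocalRing.ResidueField A)
      (IsLocalRing.ResidueField B) := by
    rw [residueDegree, dif_pos h]
  have hfin := finite_quotient_valueSubgroup (K := K) B
  let := Fintype.ofFinite (Lˣ ⧸ valueSubgroup K B)
  have hram : ramIndex K B = Fintype.card (Lˣ ⧸ valueSubgroup K B) := by
    rw [ramIndex_eq_index, Subgroup.index, Nat.card_eq_fintype_card]
  have hout : Function.Injective fun q : Lˣ ⧸ valueSubgroup K B =>
      (QuotientGroup.mk q.out : Lˣ ⧸ valueSubgroup K B) := by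
    intro q q' hqq
    simpa using hqq
  have hresfin : Module.Finite (IsLocalRing.ResidueField A) (IsLocalRing.ResidueField B) := by
    have hrank := rank_le (R := IsLocalRing.ResidueField A) (M := IsLocalRing.ResidueField B)
      (n := Module.finrank K L) fun s hs => by
        obtain ⟨y, hy⟩ := exists_resIndep A B h hs
        have := (valIndep_mul hout hy).linearIndependent.fintype_card_le_finrank
        rw [Fintype.card_prod, Fintype.card_coe] at this
        exact (Nat.le_mul_of_pos_left _ Fintype.card_pos).trans this
    exact Module.rank_lt_aleph0_iff.mp (hrank.trans_lt (Cardinal.natCast_lt_aleph0))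
  obtain ⟨y, hy⟩ := exists_resIndep A B h (Module.finBasis (IsLocalRing.ResidueField A)
    (IsLocalRing.ResidueField B)).linearIndependent
  have hval := valIndep_mul hout hy
  rw [IsDefectless, hres, hram]
  constructor
  · intro hdef
    obtain ⟨n, u, hu, hspan⟩ := hval.exists_fin
    refine ⟨n, u, hu, ?_⟩
    rw [hspan]
    exact hval.linearIndependent.span_eq_top_of_card_eq_finrank' (by simp [hdef])
  · rintro ⟨n, u, hu, hspan⟩
    refine le_antisymm ?_ ?_
    · have hn : Module.finrank K L = n := by
        rw [Module.finrank_eq_card_basis (Module.Basis.mk hu.linearIndependent hspan.ge),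
          Fintype.card_fin]
      have hcard := Finset.card_le_mul_card_image_of_maps_to (s := Finset.univ)
        (f := fun i => (QuotientGroup.mk (Units.mk0 (u i) (hu.1 i)) : Lˣ ⧸ valueSubgroup K B))
        (t := Finset.univ) (fun _ _ => Finset.mem_univ _)
        (Module.finrank (IsLocalRing.ResidueField A) (IsLocalRing.ResidueField B)) fun q _ => by
          set s := Finset.univ.filter fun i =>
            (QuotientGroup.mk (Units.mk0 (u i) (hu.1 i)) : Lˣ ⧸ valueSubgroup K B) = q with hs
          rcases s.eq_empty_or_nonempty with hempty | ⟨i₀, hi₀⟩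
          · simp [hempty]
          have hu' : ValIndep K B (u ∘ ((↑) : s → Fin n)) :=
            hu.comp_injective Subtype.val_injective
          obtain ⟨z, hz⟩ := hu'.exists_resIndep_fiber ⟨i₀, hi₀⟩ fun i =>
            (Finset.mem_filter.mp hi₀).2.trans (Finset.mem_filter.mp i.2).2.symm
          have hzB : ∀ i, z i ∈ B := fun i => B.mem_of_valuation_le_one _ (hz.1 i)
          have := ((linearIndependent_residue_iff A B h fun i => ⟨z i, hzB i⟩).mpr
            hz).fintype_card_le_finrank
          rwa [Fintype.card_coe] at this
      rwa [Finset.card_univ, Finset.card_univ, Fintype.card_fin, ← hn, mul_comm] at hcard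
    · have := hval.linearIndependent.fintype_card_le_finrank
      simpa using this

theorem valuation_comap_le_iff (B : ValuationSubring L) (f : K →+* L) (x y : K) :
    (B.comap f).valuation x ≤ (B.comap f).valuation y ↔
      B.valuation (f x) ≤ B.valuation (f y) := by
  by_cases hy : y = 0
  · simp [hy]
  have h1 : 0 < (B.comap f).valuation y := by simpa [zero_lt_iff] using hy
  have h2 : 0 < B.valuation (f y) := by simpa [zero_lt_iff] using hy
  rw [← div_le_one₀ h1, ← div_le_one₀ h2, ← map_div₀, ← map_div₀, ← map_div₀,
    ValuationSubring.valuation_le_one_iff, ValuationSubring.valuation_le_one_iff,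
    ValuationSubring.mem_comap]

theorem valIndep_comp_iff {K K' L L' : Type*} [Field K] [Field K'] [Field L] [Field L']
    [Algebra K L] [Algebra K' L'] (σ : K →+* K') (hσ : Function.Surjective σ) (f : L →+* L')
    (hf : ∀ c, f (algebraMap K L c) = algebraMap K' L' (σ c)) (B' : ValuationSubring L')
    {ι : Type*} [Fintype ι] (u : ι → L) :
    ValIndep K (B'.comap f) u ↔ ValIndep K' B' (f ∘ u) := by
  have hsmul : ∀ (c : K) (x : L), f (c • x) = σ c • f x := fun c x => by
    rw [Algebra.smul_def, map_mul, hf, Algebra.smul_def]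
  refine and_congr (by simp) ⟨fun h c i => ?_, fun h c i => ?_⟩
  · choose d hd using fun i => hσ (c i)
    have := (valuation_comap_le_iff B' f _ _).mp (h d i)
    simpa only [Function.comp_apply, map_sum, hsmul, hd] using this
  · rw [valuation_comap_le_iff]
    simpa only [Function.comp_apply, map_sum, hsmul] using h (fun i => σ (c i)) i

theorem ValIndep.map_algHom {E : Type*} [Field E] [Algebra K L] [Algebra K E] (φ : E →ₐ[K] L)
    {B : ValuationSubring L} {ι : Type*} [Fintype ι] {u : ι → E} :
    ValIndep K (B.comap (φ : E →+* L)) u ↔ ValIndep K B (φ ∘ u) :=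
  valIndep_comp_iff (RingHom.id K) Function.surjective_id (φ : E →+* L) (by simp) B u

/-- Every finite set of elements lies in a subspace that has a valuation basis. -/
def ValDefectless (K : Type*) {L : Type*} [Field K] [Field L] [Algebra K L]
    (B : ValuationSubring L) : Prop :=
  ∀ S : Finset L, ∃ (n : ℕ) (u : Fin n → L), ValIndep K B u ∧
    (S : Set L) ⊆ Submodule.span K (Set.range u)

theorem ValDefectless.isDefectless {E : Type*} [Field E] [Algebra K L] [Algebra K E]
    [FiniteDimensional K E] {B : ValuationSubring L} (hB : ValDefectless K B) (φ : E →ₐ[K] L) :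
    IsDefectless (B.comap (algebraMap K L)) (B.comap (φ : E →+* L)) := by
  rw [isDefectless_iff _ _ (by rw [ValuationSubring.comap_comap, φ.comp_algebraMap])]
  obtain ⟨n, u, hu, hS⟩ := hB (Finset.univ.image (φ ∘ Module.finBasis K E))
  have hle : LinearMap.range φ.toLinearMap ≤ Submodule.span K (Set.range u) := by
    rw [LinearMap.range_eq_map, ← (Module.finBasis K E).span_eq, Submodule.map_span,
      Submodule.span_le, ← Set.range_comp]
    simpa [Function.comp_def] using hS
  obtain ⟨m, w, hw, hspan⟩ := hu.exists_of_le_span hle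
  have hwr : ∀ i, ∃ x, φ x = w i := fun i => by
    have : w i ∈ LinearMap.range φ.toLinearMap := hspan ▸ Submodule.subset_span ⟨i, rfl⟩
    exact this
  choose x hx using hwr
  obtain rfl : w = φ ∘ x := funext fun i => (hx i).symm
  refine ⟨m, x, (ValIndep.map_algHom φ).mpr hw, ?_⟩
  apply Submodule.map_injective_of_injective (f := φ.toLinearMap) φ.injective
  rw [Submodule.map_span, ← LinearMap.range_eq_map, ← hspan, ← Set.range_comp]
  rfl

theorem isDefectlessAlgExt_iff [Algebra K L] [Algebra.IsAlgebraic K L] (A : ValuationSubring K)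
    (B : ValuationSubring L) (h : B.comap (algebraMap K L) = A) :
    IsDefectlessAlgExt A B ↔ ValDefectless K B := by
  constructor
  · intro hdef S
    have hfin : FiniteDimensional K (IntermediateField.adjoin K (S : Set L)) :=
      IntermediateField.finiteDimensional_adjoin fun x _ => Algebra.IsIntegral.isIntegral x
    obtain ⟨n, u, hu, hspan⟩ := (isDefectless_iff A _ (by
      rw [ValuationSubring.comap_comap, ← IsScalarTower.algebraMap_eq, h])).mp (hdef _ hfin)
    refine ⟨n, _, (ValIndep.map_algHom (IntermediateField.val _)).mp hu, fun x hx => ?_⟩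
    have hmem : (⟨x, IntermediateField.subset_adjoin K _ hx⟩ :
        IntermediateField.adjoin K (S : Set L)) ∈ Submodule.span K (Set.range u) :=
      hspan ▸ Submodule.mem_top
    have := Submodule.mem_map_of_mem (f := (IntermediateField.val _).toLinearMap) hmem
    rw [Submodule.map_span, ← Set.range_comp] at this
    exact this
  · intro hB E hE
    subst h
    exact hB.isDefectless E.val

theorem ValDefectless.of_ringEquiv {K K' L L' : Type*} [Field K] [Field K'] [Field L] [Field L']
    [Algebra K L] [Algebra K' L'] (σ : K ≃+* K') (f : L ≃+* L')
    (hf : ∀ c, f (algebraMap K L c) = algebraMap K' L' (σ c)) {B' : ValuationSubring L'}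
    (h : ValDefectless K (B'.comap (f : L →+* L'))) : ValDefectless K' B' := by
  intro S
  obtain ⟨n, u, hu, hS⟩ := h (S.image f.symm)
  refine ⟨n, f ∘ u, (valIndep_comp_iff (σ : K →+* K') σ.surjective (f : L →+* L') hf B' u).mp hu,
    fun x hx => ?_⟩
  obtain ⟨c, hc⟩ := (Submodule.mem_span_range_iff_exists_fun K).mp
    (hS (Finset.mem_coe.mpr (Finset.mem_image_of_mem f.symm hx)))
  refine (Submodule.mem_span_range_iff_exists_fun K').mpr ⟨fun i => σ (c i), ?_⟩
  apply f.symm.injective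
  rw [← hc, RingEquiv.symm_apply_eq, map_sum]
  simp [Algebra.smul_def, hf]

theorem isDefectless_of_algEquiv {E : Type*} [Field E] [Algebra K L] [Algebra K E]
    [FiniteDimensional K L] (e : E ≃ₐ[K] L) {A : ValuationSubring K} {B : ValuationSubring L}
    (h : B.comap (algebraMap K L) = A) (hB : IsDefectless A B) :
    IsDefectless A (B.comap (e : E →+* L)) := by
  have hfin : FiniteDimensional K E := e.symm.toLinearEquiv.finiteDimensional
  subst h
  refine ValDefectless.isDefectless (fun S => ?_) e.toAlgHom
  obtain ⟨n, u, hu, hspan⟩ := (isDefectless_iff _ B rfl).mp hB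
  exact ⟨n, u, hu, by simp [hspan]⟩

theorem pow_mem_valuationSubring_iff (B : ValuationSubring L) {n : ℕ} (hn : n ≠ 0) (x : L) :
    x ^ n ∈ B ↔ x ∈ B := by
  rw [← ValuationSubring.valuation_le_one_iff, ← ValuationSubring.valuation_le_one_iff, map_pow,
    pow_le_one_iff hn]

theorem comap_eq_of_isPurelyInseparable [Algebra K L] {E : Type*} [Field E] [Algebra K E] (p : ℕ)
    [ExpChar K p] [IsPurelyInseparable K E] {B : ValuationSubring L} {C : ValuationSubring E}
    (h : B.comap (algebraMap K L) = C.comap (algebraMap K E)) (φ : E →ₐ[K] L) :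
    B.comap (φ : E →+* L) = C := by
  ext x
  obtain ⟨n, y, hy⟩ := IsPurelyInseparable.pow_mem K p x
  have hn : p ^ n ≠ 0 := pow_ne_zero _ (expChar_ne_zero K p)
  rw [← pow_mem_valuationSubring_iff _ hn, ← pow_mem_valuationSubring_iff C hn, ← hy,
    ← ValuationSubring.mem_comap, ← ValuationSubring.mem_comap, ← h,
    ValuationSubring.comap_comap, φ.comp_algebraMap]

/-- The products of `p`-th roots of a valuation independent family with a valuation independent
family of `p`-th roots of elements of `K` are valuation independent. -/
theorem ValIndep.mul_roots [Algebra K L] (p : ℕ) [ExpChar L p] {B : ValuationSubring L}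
    {ι κ : Type*} [Fintype ι] [Fintype κ] {r : ι → L} {w : κ → L}
    (hr : ValIndep K B fun i => r i ^ p) (hw : ValIndep K B w)
    (hwp : ∀ j, w j ^ p ∈ (algebraMap K L).range) :
    ValIndep K B fun ij : κ × ι => w ij.1 * r ij.2 := by
  have hp0 : p ≠ 0 := expChar_ne_zero L p
  refine ⟨fun ij => mul_ne_zero (hw.1 _) fun h0 => hr.1 ij.2 (by simp [h0, hp0]), fun c ij => ?_⟩
  have hz : ∀ i, ∃ d : K, algebraMap K L d = (∑ j, c (j, i) • w j) ^ p := by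
    intro i
    rw [sum_pow_char]
    refine (algebraMap K L).range.sum_mem fun j _ => ?_
    rw [Algebra.smul_def, mul_pow, ← map_pow]
    exact (algebraMap K L).range.mul_mem ⟨_, rfl⟩ (hwp j)
  choose d hd using hz
  have hsum : (∑ ij : κ × ι, c ij • (w ij.1 * r ij.2)) ^ p = ∑ i, d i • r i ^ p := by
    rw [Fintype.sum_prod_type_right, sum_pow_char]
    refine Finset.sum_congr rfl fun i _ => ?_
    rw [Algebra.smul_def, hd, ← mul_pow, Finset.sum_mul]
    simp_rw [smul_mul_assoc]
  have h1 := hr.2 d ij.2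
  rw [← hsum, Algebra.smul_def, hd, ← mul_pow, map_pow, map_pow,
    pow_le_pow_iff_left₀ zero_le zero_le hp0] at h1
  refine le_trans ?_ h1
  rw [← smul_mul_assoc, map_mul, map_mul]
  gcongr
  exact hw.2 (fun j => c (j, ij.2)) ij.1

theorem valDefectless_of_roots [Algebra K L] (p : ℕ) [ExpChar K p] [ExpChar L p] [PerfectRing L p]
    [IsPurelyInseparable K L] {B : ValuationSubring L}
    (h : ∀ S : Finset L, (∀ s ∈ S, s ^ p ∈ (algebraMap K L).range) →
      ∃ (n : ℕ) (w : Fin n → L), ValIndep K B w ∧ (∀ j, w j ^ p ∈ (algebraMap K L).range) ∧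
        (S : Set L) ⊆ Submodule.span K (Set.range w)) :
    ValDefectless K B := by
  have key : ∀ (m : ℕ) (S : Finset L), (∀ s ∈ S, s ^ p ^ m ∈ (algebraMap K L).range) →
      ∃ (n : ℕ) (u : Fin n → L), ValIndep K B u ∧
        (S : Set L) ⊆ Submodule.span K (Set.range u) := by
    intro m
    induction m with
    | zero =>
      intro S hS
      obtain ⟨n, w, hw, -, hSw⟩ := h S fun s hs =>
        Subring.pow_mem _ (by simpa using hS s hs) p
      exact ⟨n, w, hw, hSw⟩
    | succ m ih =>
      intro S hS
      obtain ⟨n, u, hu, hSu⟩ := ih (S.image (· ^ p)) fun s hs => by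
        obtain ⟨t, ht, rfl⟩ := Finset.mem_image.mp hs
        rw [← pow_mul, ← pow_succ']
        exact hS t ht
      have hroot : ∀ x : L, ∃ y : L, y ^ p = x := surjective_frobenius L p
      choose root hroot using hroot
      have hrep : ∀ s : S, ∃ c : Fin n → K, ∑ i, c i • u i = (s : L) ^ p := fun s =>
        (Submodule.mem_span_range_iff_exists_fun K).mp
          (hSu (Finset.mem_coe.mpr (Finset.mem_image_of_mem _ s.2)))
      choose c hc using hrep
      obtain ⟨n', w, hw, hwp, hSw⟩ := h
        (Finset.univ.image fun si : S × Fin n => root (algebraMap K L (c si.1 si.2)))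
        fun s hs => by
          obtain ⟨t, -, rfl⟩ := Finset.mem_image.mp hs
          rw [hroot]
          exact ⟨_, rfl⟩
      have hu' : ValIndep K B fun i => root (u i) ^ p := by
        simpa only [hroot] using hu
      obtain ⟨k, v, hv, hrange⟩ := (hu'.mul_roots p hw hwp).exists_fin
      refine ⟨k, v, hv, fun s hs => ?_⟩
      have hs' : s = ∑ i, root (algebraMap K L (c ⟨s, hs⟩ i)) * root (u i) := by
        apply frobenius_inj L p
        rw [frobenius_def, frobenius_def, sum_pow_char, ← hc ⟨s, hs⟩]
        simp_rw [mul_pow, hroot, Algebra.smul_def]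
      rw [hrange, hs']
      refine Submodule.sum_mem _ fun i _ => ?_
      obtain ⟨b, hb⟩ := (Submodule.mem_span_range_iff_exists_fun K).mp
        (hSw (Finset.mem_coe.mpr (Finset.mem_image_of_mem _
          (Finset.mem_univ ((⟨s, hs⟩, i) : S × Fin n)))))
      rw [← hb, Finset.sum_mul]
      refine Submodule.sum_mem _ fun j _ => ?_
      rw [smul_mul_assoc]
      exact Submodule.smul_mem _ _ (Submodule.subset_span ⟨(j, i), rfl⟩)
  intro S
  choose e he using fun x : L => IsPurelyInseparable.pow_mem K p x
  refine key (S.sup e) S fun s hs => ?_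
  obtain ⟨k, hk⟩ := Nat.exists_eq_add_of_le (Finset.le_sup (f := e) hs)
  rw [hk, pow_add, pow_mul]
  exact Subring.pow_mem _ (he s) _

theorem mem_pthRootField_iff [Algebra K L] (p : ℕ) (hp : p.Prime) [CharP K p] {x : L} :
    x ∈ pthRootField K L p hp ↔ x ^ p ∈ (algebraMap K L).range :=
  Iff.rfl

theorem valDefectless_of_pthRootField [Algebra K L] (p : ℕ) (hp : p.Prime) [CharP K p]
    [ExpChar K p] [ExpChar L p] [PerfectRing L p] [IsPurelyInseparable K L]
    {B : ValuationSubring L}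
    (h : ValDefectless K (B.comap (algebraMap (pthRootField K L p hp) L))) :
    ValDefectless K B := by
  refine valDefectless_of_roots p fun S hS => ?_
  obtain ⟨n, u, hu, hSu⟩ := h (Finset.univ.image fun s : S =>
    (⟨s, (mem_pthRootField_iff p hp).mpr (hS s s.2)⟩ : pthRootField K L p hp))
  refine ⟨n, _, (ValIndep.map_algHom (IntermediateField.val _)).mp hu, fun j => (u j).2,
    fun x hx => ?_⟩
  have := Submodule.mem_map_of_mem (f := (IntermediateField.val _).toLinearMap)
    (hSu (Finset.mem_coe.mpr (Finset.mem_image_of_mem _ (Finset.mem_univ (⟨x, hx⟩ : S)))))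
  rw [Submodule.map_span, ← Set.range_comp] at this
  exact this

/-- The Frobenius isomorphism from `K` to `K^p`. -/
def pPowerEquiv (K : Type*) [Field K] (p : ℕ) (hp : p.Prime) [CharP K p] :
    K ≃+* pPowerSubfield K p hp :=
  haveI : Fact p.Prime := ⟨hp⟩
  RingEquiv.ofBijective (frobenius K p).rangeRestrictField
    ⟨RingHom.injective _, (frobenius K p).rangeRestrict_surjective⟩

theorem coe_pPowerEquiv (p : ℕ) (hp : p.Prime) [CharP K p] (x : K) :
    (pPowerEquiv K p hp x : K) = x ^ p :=
  rfl

theorem exists_pthRootEquiv [Algebra K L] (p : ℕ) (hp : p.Prime) [CharP K p] [ExpChar L p]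
    [PerfectRing L p] :
    ∃ e : K ≃+* pthRootField K L p hp, ∀ x : K, (e x : L) ^ p = algebraMap K L x := by
  let f : K →+* pthRootField K L p hp :=
    (((frobeniusEquiv L p).symm : L →+* L).comp (algebraMap K L)).codRestrict _ fun x => by
      rw [mem_pthRootField_iff]
      exact ⟨x, by simp⟩
  have hf : ∀ x, (f x : L) ^ p = algebraMap K L x := fun x => by simp [f]
  refine ⟨RingEquiv.ofBijective f ⟨f.injective, fun y => ?_⟩, hf⟩
  obtain ⟨c, hc⟩ := (mem_pthRootField_iff p hp).mp y.2
  exact ⟨c, Subtype.ext (frobenius_inj L p ((hf c).trans hc))⟩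

theorem valDefectless_pthRootField_iff [Algebra K L] (p : ℕ) (hp : p.Prime) [CharP K p]
    [ExpChar L p] [PerfectRing L p] (A : ValuationSubring K) (B : ValuationSubring L)
    (hB : B.comap (algebraMap K L) = A) :
    ValDefectless K (B.comap (algebraMap (pthRootField K L p hp) L)) ↔
      ValDefectless (pPowerSubfield K p hp) A := by
  obtain ⟨e, he⟩ := exists_pthRootEquiv (L := L) p hp (K := K)
  have hcomap : (B.comap (algebraMap (pthRootField K L p hp) L)).comap
      (e : K →+* pthRootField K L p hp) = A := by
    ext x
    rw [← hB, ValuationSubring.mem_comap, ValuationSubring.mem_comap, ValuationSubring.mem_comap,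
      ← he, pow_mem_valuationSubring_iff B hp.ne_zero]
    rfl
  have hcomm : ∀ c : K, e (c ^ p) = algebraMap K (pthRootField K L p hp) c := by
    intro c
    apply Subtype.ext
    apply frobenius_inj L p
    rw [frobenius_def, he, map_pow]
    rfl
  constructor
  · intro h
    refine ValDefectless.of_ringEquiv (pPowerEquiv K p hp) e.symm (fun c => ?_) (K := K)
      (L := pthRootField K L p hp) ?_
    · rw [RingEquiv.symm_apply_eq, ← hcomm]
      rfl
    · rw [← hcomap, ValuationSubring.comap_comap]
      convert h
      ext x
      simp [ValuationSubring.mem_comap]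
  · intro h
    refine ValDefectless.of_ringEquiv (pPowerEquiv K p hp).symm e (fun c => ?_)
      (by rwa [hcomap])
    obtain ⟨d, rfl⟩ := (pPowerEquiv K p hp).surjective c
    rw [RingEquiv.symm_apply_apply, ← hcomm]
    rfl

/-- `(K,v)` is inseparably defectless iff `(K^{1/p}|K,v)` is defectless iff `(K|K^p,v)` is
defectless. -/
theorem statement17 {K : Type u} {P : Type v} [Field K] [Field P] [Algebra K P]
    (p : ℕ) (hp : p.Prime) [CharP K p]
    [IsPurelyInseparable K P] [PerfectField P]
    (A : ValuationSubring K) (B : ValuationSubring P)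
    (hB : B.comap (algebraMap K P) = A) :
    (IsInsepDefectless A ↔
      IsDefectlessAlgExt A (B.comap (algebraMap (pthRootField K P p hp) P))) ∧
    (IsInsepDefectless A ↔
      IsDefectlessAlgExt (A.comap (algebraMap (pPowerSubfield K p hp) K)) A) := by
  have : Fact p.Prime := ⟨hp⟩
  have : ExpChar K p := ExpChar.prime hp
  have : CharP P p := charP_of_injective_algebraMap (algebraMap K P).injective p
  have : ExpChar P p := ExpChar.prime hp
  have : PerfectRing P p := PerfectField.toPerfectRing p
  have hcomap : (B.comap (algebraMap (pthRootField K P p hp) P)).comap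
      (algebraMap K (pthRootField K P p hp)) = A := by
    rw [ValuationSubring.comap_comap, ← IsScalarTower.algebraMap_eq, hB]
  have halg : Algebra.IsAlgebraic (pPowerSubfield K p hp) K := ⟨fun x =>
    ((isIntegral_algebraMap (x := pPowerEquiv K p hp x)).of_pow hp.pos).isAlgebraic⟩
  have hroot : IsInsepDefectless A ↔
      IsDefectlessAlgExt A (B.comap (algebraMap (pthRootField K P p hp) P)) := by
    constructor
    · intro h E hE
      have hEpi : IsPurelyInseparable K E := inferInstance
      let φ : E →ₐ[K] AlgebraicClosure K := IsAlgClosed.lift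
      let e : E ≃ₐ[K] φ.fieldRange := AlgEquiv.ofInjectiveField φ
      have hfin : FiniteDimensional K φ.fieldRange := e.toLinearEquiv.finiteDimensional
      have hpi : IsPurelyInseparable K φ.fieldRange := e.isPurelyInseparable
      set C := (B.comap (algebraMap (pthRootField K P p hp) P)).comap
        (algebraMap E (pthRootField K P p hp)) with hC
      have hCA : C.comap (algebraMap K E) = A := by
        rw [hC, ValuationSubring.comap_comap, ← IsScalarTower.algebraMap_eq, hcomap]
      have hD : (C.comap (e.symm : φ.fieldRange →+* E)).comap (algebraMap K φ.fieldRange) = A := by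
        rw [ValuationSubring.comap_comap, ← hCA]
        exact congrArg _ (RingHom.ext fun x => e.symm.commutes x)
      have := isDefectless_of_algEquiv e hD (h φ.fieldRange hfin hpi _ hD)
      rw [ValuationSubring.comap_comap] at this
      convert this
      ext x
      simp [ValuationSubring.mem_comap]
    · intro h L _ _ hfin hpi C hC
      have hval := valDefectless_of_pthRootField p hp ((isDefectlessAlgExt_iff A _ hcomap).mp h)
      obtain ⟨φ⟩ : Nonempty (L →ₐ[K] P) := inferInstance
      have := hval.isDefectless φ
      rwa [comap_eq_of_isPurelyInseparable p (hB.trans hC.symm) φ, hB] at this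
  refine ⟨hroot, hroot.trans ?_⟩
  rw [isDefectlessAlgExt_iff A _ hcomap, isDefectlessAlgExt_iff _ A rfl]
  exact valDefectless_pthRootField_iff p hp A B hB

end ValuedDefect
end
end
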